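/- arXiv:2205.08627 — 2 statements merged into one kernel-verified Lean document; each statement's English description precedes it below -/
import Mathlib

section
/- Let d = 3, 𝕊 = {{1,2},{2,3},{1,3}}, X_1 = [r] with r ≥ 2, X_2 = [2] and X_3 = [2]. There exists a universal constant c > 0 such that for all r ≥ 2 and all sample sizes n_𝕊, the minimax testing radius satisfies ρ*(n_𝕊) ≥ c · max{ min( 1/log r, ( r / ((min(n_{{1,2}}, n_{{1,3}})) · log r) )^{1/2} ), (min_{S∈𝕊} n_S)^{−1/2} }. -/
/-- The family `(P_{{1,2}}, P_{{2,3}}, P_{{1,3}})` of pairwise mass functions on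
`[r] × [s] × [u]` consists of probability mass functions. -/
def ProbTriple (r s u : ℕ) (p12 : Fin r → Fin s → ℝ) (p23 : Fin s → Fin u → ℝ)
    (p13 : Fin r → Fin u → ℝ) : Prop :=
  (∀ i j, 0 ≤ p12 i j) ∧ (∀ j k, 0 ≤ p23 j k) ∧ (∀ i k, 0 ≤ p13 i k) ∧
    (∑ i, ∑ j, p12 i j = 1) ∧ (∑ j, ∑ k, p23 j k = 1) ∧ (∑ i, ∑ k, p13 i k = 1)

/-- Consistency of the family of pairwise margins. -/
def ConsTriple (r s u : ℕ) (p12 : Fin r → Fin s → ℝ) (p23 : Fin s → Fin u → ℝ)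
    (p13 : Fin r → Fin u → ℝ) : Prop :=
  (∀ i, ∑ j, p12 i j = ∑ k, p13 i k) ∧
    (∀ j, ∑ i, p12 i j = ∑ k, p23 j k) ∧
    (∀ k, ∑ j, p23 j k = ∑ i, p13 i k)

/-- Compatibility: existence of a joint pmf on `[r] × [s] × [u]` with the given margins. -/
def CompatTriple (r s u : ℕ) (p12 : Fin r → Fin s → ℝ) (p23 : Fin s → Fin u → ℝ)
    (p13 : Fin r → Fin u → ℝ) : Prop :=
  ∃ q : Fin r → Fin s → Fin u → ℝ,
    (∀ i j k, 0 ≤ q i j k) ∧ (∑ i, ∑ j, ∑ k, q i j k = 1) ∧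
      (∀ i j, p12 i j = ∑ k, q i j k) ∧ (∀ j k, p23 j k = ∑ i, q i j k) ∧
      (∀ i k, p13 i k = ∑ j, q i j k)

/-- The incompatibility index `R(P_𝕊)` for `𝕊 = {{1,2},{2,3},{1,3}}`. -/
noncomputable def RTriple (r s u : ℕ) (p12 : Fin r → Fin s → ℝ) (p23 : Fin s → Fin u → ℝ)
    (p13 : Fin r → Fin u → ℝ) : ℝ :=
  sSup {t | ∃ (f12 : Fin r → Fin s → ℝ) (f23 : Fin s → Fin u → ℝ) (f13 : Fin r → Fin u → ℝ),
    (∀ i j, -1 ≤ f12 i j) ∧ (∀ j k, -1 ≤ f23 j k) ∧ (∀ i k, -1 ≤ f13 i k) ∧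
    (∀ i j k, 0 ≤ f12 i j + f23 j k + f13 i k) ∧
    t = -(1 / 3) * ((∑ i, ∑ j, f12 i j * p12 i j) + (∑ j, ∑ k, f23 j k * p23 j k) +
          (∑ i, ∑ k, f13 i k * p13 i k))}

/-- The sample space for `n_{{1,2}}, n_{{2,3}}, n_{{1,3}}` independent observations of the
three observed margins on `[r] × [2] × [2]`. -/
abbrev SampleSpace (r n12 n23 n13 : ℕ) : Type :=
  (Fin n12 → Fin r × Fin 2) × (Fin n23 → Fin 2 × Fin 2) × (Fin n13 → Fin r × Fin 2)

/-- Expectation of a test statistic under the joint law of the independent data. -/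
noncomputable def expTest (r n12 n23 n13 : ℕ) (ψ : SampleSpace r n12 n23 n13 → ℝ)
    (p12 : Fin r → Fin 2 → ℝ) (p23 : Fin 2 → Fin 2 → ℝ) (p13 : Fin r → Fin 2 → ℝ) : ℝ :=
  ∑ ω : SampleSpace r n12 n23 n13,
    ψ ω * ((∏ i, p12 (ω.1 i).1 (ω.1 i).2) * (∏ i, p23 (ω.2.1 i).1 (ω.2.1 i).2) *
      (∏ i, p13 (ω.2.2 i).1 (ω.2.2 i).2))

/-- The minimax risk `ℛ(n_𝕊, ρ)`. -/
noncomputable def minimaxRisk (r n12 n23 n13 : ℕ) (ρ : ℝ) : ℝ :=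
  sInf {t : ℝ | ∃ ψ : SampleSpace r n12 n23 n13 → ℝ, (∀ ω, ψ ω ∈ Set.Icc (0 : ℝ) 1) ∧
    t = sSup {x | ∃ p12 p23 p13, ProbTriple r 2 2 p12 p23 p13 ∧
            CompatTriple r 2 2 p12 p23 p13 ∧ x = expTest r n12 n23 n13 ψ p12 p23 p13} +
        sSup {x | ∃ p12 p23 p13, ProbTriple r 2 2 p12 p23 p13 ∧
            ρ ≤ RTriple r 2 2 p12 p23 p13 ∧
            x = expTest r n12 n23 n13 (fun ω => 1 - ψ ω) p12 p23 p13}}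

/-- The minimax testing radius `ρ*(n_𝕊)`. -/
noncomputable def rhoStar (r n12 n23 n13 : ℕ) : ℝ :=
  sInf {ρ : ℝ | 0 ≤ ρ ∧ minimaxRisk r n12 n23 n13 ρ ≤ 1 / 2}

open Finset in
lemma sum_cos_mul_sin_half (α : ℝ) (Q : ℕ) :
    2 * Real.sin (α / 2) * ∑ j ∈ range Q, Real.cos (j * α) =
      Real.sin (Q * α - α / 2) + Real.sin (α / 2) := by
  induction Q with
  | zero => simp [Real.sin_neg]
  | succ Q ih =>
    rw [sum_range_succ, mul_add, ih]
    have h1 : ((Q + 1 : ℕ) : ℝ) * α - α / 2 = Q * α + α / 2 := by push_cast; ring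
    rw [h1, Real.sin_add, Real.sin_sub]; ring

open Finset in
lemma sum_sin_mul_sin_half (α : ℝ) (Q : ℕ) :
    2 * Real.sin (α / 2) * ∑ j ∈ range Q, Real.sin (j * α) =
      Real.cos (α / 2) - Real.cos (Q * α - α / 2) := by
  induction Q with
  | zero => simp [Real.cos_neg]
  | succ Q ih =>
    rw [sum_range_succ, mul_add, ih]
    have h1 : ((Q + 1 : ℕ) : ℝ) * α - α / 2 = Q * α + α / 2 := by push_cast; ring
    rw [h1, Real.cos_add, Real.cos_sub]; ring

lemma sin_pi_mul_div_pos {n Q : ℝ} (hn : 0 < n) (hQ : n < Q) : 0 < Real.sin (Real.pi * n / Q) := by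
  have hQ0 : 0 < Q := hn.trans hQ
  apply Real.sin_pos_of_pos_of_lt_pi
  · have := Real.pi_pos
    positivity
  · rw [div_lt_iff₀ hQ0]
    exact mul_lt_mul_of_pos_left hQ Real.pi_pos

open Finset in
/-- Orthogonality of a nontrivial character of `ℤ/Q` to the constants. -/
lemma sum_cos_eq_zero {n : ℤ} {Q : ℕ} (hn : n ≠ 0) (hQ : |n| < Q) :
    ∑ j ∈ range Q, Real.cos (n * (2 * Real.pi * j / Q)) = 0 := by
  wlog h : 0 < n generalizing n
  · have := this (n := -n) (by simpa using hn) (by simpa using hQ) (by omega)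
    rw [← this]
    refine sum_congr rfl fun j _ => ?_
    rw [← Real.cos_neg]
    push_cast
    ring_nf
  have hQ' : (n : ℝ) < Q := by
    rw [abs_of_pos h] at hQ
    exact_mod_cast hQ
  have hn' : (0 : ℝ) < n := by exact_mod_cast h
  have hQ0 : (Q : ℝ) ≠ 0 := (hn'.trans hQ').ne'
  have key := sum_cos_mul_sin_half (2 * Real.pi * n / Q) Q
  have hs := sin_pi_mul_div_pos hn' hQ'
  have e1 : 2 * Real.pi * n / Q / 2 = Real.pi * n / Q := by ring
  have e2 : (Q : ℝ) * (2 * Real.pi * n / Q) - Real.pi * n / Q =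
      -(Real.pi * n / Q) + n * (2 * Real.pi) := by
    field_simp
    ring
  rw [e1, e2, Real.sin_add_int_mul_two_pi, Real.sin_neg, neg_add_cancel] at key
  have := (mul_eq_zero.mp key).resolve_left (by positivity)
  rw [← this]
  refine sum_congr rfl fun j _ => ?_
  ring_nf

open Finset in
lemma sum_sin_odd {n : ℝ} {m : ℤ} {Q : ℕ} (hm : n = 2 * m + 1) (hn : 0 < n) (hQ : n < 2 * Q) :
    ∑ j ∈ range Q, Real.sin (j * (Real.pi * n / Q)) =
      Real.cos (Real.pi * n / (2 * Q)) / Real.sin (Real.pi * n / (2 * Q)) := by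
  have hQ0 : (Q : ℝ) ≠ 0 := by
    intro h
    rw [h] at hQ
    linarith
  have hs := sin_pi_mul_div_pos hn hQ
  have key := sum_sin_mul_sin_half (Real.pi * n / Q) Q
  have e1 : Real.pi * n / Q / 2 = Real.pi * n / (2 * Q) := by ring
  have e2 : (Q : ℝ) * (Real.pi * n / Q) - Real.pi * n / (2 * Q) =
      Real.pi - Real.pi * n / (2 * Q) + m * (2 * Real.pi) := by
    rw [hm]
    field_simp
    ring
  rw [e1, e2, Real.cos_add_int_mul_two_pi, Real.cos_pi_sub] at key
  rw [eq_div_iff hs.ne']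
  linarith

open Finset in
/-- The discrete Fourier coefficients of `sin (ψ / 2)` on the grid `2πj/Q` are negative and of
order at least `n⁻²`. -/
lemma sum_sin_half_mul_cos_le {n Q : ℕ} (hn : 0 < n) (hQ : n < Q) :
    ∑ j ∈ range Q, Real.sin (Real.pi * j / Q) * Real.cos (n * (2 * Real.pi * j / Q)) ≤
      -(Q / (Real.pi ^ 2 * n ^ 2)) := by
  have hn1 : (1 : ℝ) ≤ n := by exact_mod_cast hn
  have hQ1 : (n : ℝ) + 1 ≤ Q := by exact_mod_cast hQ
  have hQ0 : (0 : ℝ) < Q := by linarith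
  have hpi := Real.pi_pos
  have h1 := sum_sin_odd (n := 2 * n + 1) (m := n) (Q := Q) (by push_cast; ring) (by linarith)
    (by linarith)
  have h2 := sum_sin_odd (n := 2 * n - 1) (m := n - 1) (Q := Q) (by push_cast; ring)
    (by linarith) (by linarith)
  have s1 := sin_pi_mul_div_pos (n := 2 * n + 1) (Q := 2 * Q) (by linarith) (by linarith)
  have s2 := sin_pi_mul_div_pos (n := 2 * n - 1) (Q := 2 * Q) (by linarith) (by linarith)
  have hsum : ∑ j ∈ range Q, Real.sin (Real.pi * j / Q) * Real.cos (n * (2 * Real.pi * j / Q)) =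
      1 / 2 * (∑ j ∈ range Q, Real.sin (j * (Real.pi * (2 * n + 1) / Q)) -
        ∑ j ∈ range Q, Real.sin (j * (Real.pi * (2 * n - 1) / Q))) := by
    rw [← sum_sub_distrib, mul_sum]
    refine sum_congr rfl fun j _ => ?_
    have a1 : (j : ℝ) * (Real.pi * (2 * n + 1) / Q) =
      n * (2 * Real.pi * j / Q) + Real.pi * j / Q := by ring
    have a2 : (j : ℝ) * (Real.pi * (2 * n - 1) / Q) =
      n * (2 * Real.pi * j / Q) - Real.pi * j / Q := by ring
    rw [a1, a2, Real.sin_add, Real.sin_sub]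
    ring
  rw [hsum, h1, h2]
  set b1 := Real.pi * (2 * n + 1) / (2 * Q) with hb1
  set b2 := Real.pi * (2 * n - 1) / (2 * Q) with hb2
  have hd : Real.sin (Real.pi / Q) =
      Real.sin b1 * Real.cos b2 - Real.cos b1 * Real.sin b2 := by
    rw [← Real.sin_sub, hb1, hb2]
    congr 1
    field_simp
    ring
  have hlow : 2 / (Q : ℝ) ≤ Real.sin (Real.pi / Q) := by
    have := Real.mul_le_sin (x := Real.pi / Q) (by positivity) (by
      apply div_le_div_of_nonneg_left hpi.le (by norm_num); linarith)
    refine le_trans (le_of_eq ?_) this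
    field_simp
  have hb2n : 0 ≤ b2 := by
    rw [hb2]
    apply div_nonneg (mul_nonneg hpi.le (by linarith)) (by linarith)
  have hup : Real.sin b1 * Real.sin b2 ≤ Real.pi ^ 2 * n ^ 2 / Q ^ 2 := by
    have : Real.sin b1 * Real.sin b2 ≤ b1 * b2 :=
      mul_le_mul (Real.sin_le (by positivity)) (Real.sin_le hb2n) s2.le (by positivity)
    refine this.trans ?_
    have e : b1 * b2 = Real.pi ^ 2 * (n ^ 2 - 1 / 4) / Q ^ 2 := by
      rw [hb1, hb2]; field_simp; ring
    rw [e]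
    gcongr
    linarith
  have e : 1 / 2 * (Real.cos b1 / Real.sin b1 - Real.cos b2 / Real.sin b2) =
      -(1 / 2 * Real.sin (Real.pi / Q) / (Real.sin b1 * Real.sin b2)) := by
    rw [hd]
    field_simp
    ring
  rw [e]
  apply neg_le_neg
  have e3 : (Q : ℝ) / (Real.pi ^ 2 * n ^ 2) =
      (1 / 2 * (2 / Q)) / (Real.pi ^ 2 * n ^ 2 / Q ^ 2) := by field_simp
  rw [e3]
  have : 0 < Real.sin b1 * Real.sin b2 := mul_pos s1 s2
  have hs : 0 < Real.sin (Real.pi / Q) := lt_of_lt_of_le (by positivity) hlow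
  gcongr

open Finset in
lemma sum_pow_mul_cos_eq_zero {Q : ℕ} (l : ℕ) : ∀ n : ℤ, (l : ℤ) < n → n + l < Q →
    ∑ j ∈ range Q, (1 - Real.cos (2 * Real.pi * j / Q)) ^ l *
      Real.cos (n * (2 * Real.pi * j / Q)) = 0 := by
  induction l with
  | zero =>
    intro n h1 h2
    simp only [pow_zero, one_mul]
    apply sum_cos_eq_zero (by simp at h1; omega)
    rw [abs_of_pos (by simpa using h1)]
    simpa using h2
  | succ l ih =>
    intro n h1 h2
    push_cast at h1 h2
    have a := ih n (by omega) (by omega)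
    have b := ih (n + 1) (by omega) (by omega)
    have c := ih (n - 1) (by omega) (by omega)
    have : ∀ j : ℕ, (1 - Real.cos (2 * Real.pi * j / Q)) ^ (l + 1) *
        Real.cos (n * (2 * Real.pi * j / Q)) =
        (1 - Real.cos (2 * Real.pi * j / Q)) ^ l * Real.cos (n * (2 * Real.pi * j / Q)) -
        1 / 2 * ((1 - Real.cos (2 * Real.pi * j / Q)) ^ l *
          Real.cos ((n + 1 : ℤ) * (2 * Real.pi * j / Q))) -
        1 / 2 * ((1 - Real.cos (2 * Real.pi * j / Q)) ^ l *
          Real.cos ((n - 1 : ℤ) * (2 * Real.pi * j / Q))) := by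
      intro j
      push_cast
      rw [add_mul, sub_mul, one_mul, Real.cos_add, Real.cos_sub]
      ring
    simp only [this, sum_sub_distrib, ← mul_sum, a, b, c]
    simp

/-- The Fejér kernel, up to the normalizing factor `1 / M`. -/
noncomputable def fejerSum (M : ℕ) (ψ : ℝ) : ℝ :=
  ∑ k ∈ Finset.range M, ∑ l ∈ Finset.range M, Real.cos (((k : ℝ) - l) * ψ)

open Finset in
lemma fejerSum_nonneg (M : ℕ) (ψ : ℝ) : 0 ≤ fejerSum M ψ := by
  have : fejerSum M ψ = (∑ k ∈ range M, Real.cos (k * ψ)) ^ 2 +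
      (∑ k ∈ range M, Real.sin (k * ψ)) ^ 2 := by
    rw [fejerSum, sq, sq, sum_mul_sum, sum_mul_sum, ← sum_add_distrib]
    refine sum_congr rfl fun k _ => ?_
    rw [← sum_add_distrib]
    refine sum_congr rfl fun l _ => ?_
    rw [sub_mul, Real.cos_sub]
  rw [this]
  positivity

open Finset in
lemma fejerSum_mul_cos (M : ℕ) (N ψ : ℝ) :
    fejerSum M ψ * Real.cos (N * ψ) =
      ∑ k ∈ range M, ∑ l ∈ range M, Real.cos ((N + k - l) * ψ) := by
  have h0 : ∑ k ∈ range M, ∑ l ∈ range M, Real.sin (((k : ℝ) - l) * ψ) = 0 := by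
    have : ∑ k ∈ range M, ∑ l ∈ range M, Real.sin (((k : ℝ) - l) * ψ) =
        -∑ k ∈ range M, ∑ l ∈ range M, Real.sin (((k : ℝ) - l) * ψ) := by
      conv_lhs => rw [sum_comm]
      rw [← sum_neg_distrib]
      refine sum_congr rfl fun k _ => ?_
      rw [← sum_neg_distrib]
      refine sum_congr rfl fun l _ => ?_
      rw [← Real.sin_neg]
      ring_nf
    linarith
  have : ∑ k ∈ range M, ∑ l ∈ range M, Real.cos ((N + k - l) * ψ) =
      fejerSum M ψ * Real.cos (N * ψ) -
        Real.sin (N * ψ) * ∑ k ∈ range M, ∑ l ∈ range M, Real.sin (((k : ℝ) - l) * ψ) := by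
    rw [fejerSum, sum_mul, mul_sum, ← sum_sub_distrib]
    refine sum_congr rfl fun k _ => ?_
    rw [sum_mul, mul_sum, ← sum_sub_distrib]
    refine sum_congr rfl fun l _ => ?_
    rw [show (N + k - l) * ψ = N * ψ + ((k : ℝ) - l) * ψ by ring, Real.cos_add]
    ring
  rw [this, h0]
  ring

open Finset in
lemma sum_fejerSum {M Q : ℕ} (hQ : M ≤ Q) :
    ∑ j ∈ range Q, fejerSum M (2 * Real.pi * j / Q) = M * Q := by
  simp only [fejerSum]
  rw [sum_comm]
  have : ∀ k ∈ range M, ∑ j ∈ range Q, ∑ l ∈ range M,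
      Real.cos (((k : ℝ) - l) * (2 * Real.pi * j / Q)) = Q := by
    intro k hk
    rw [sum_comm, sum_eq_single_of_mem k hk]
    · simp
    · intro l hl hlk
      have := sum_cos_eq_zero (n := (k : ℤ) - l) (Q := Q) (by omega) (by
        simp only [mem_range] at hk hl
        rw [abs_lt]
        omega)
      simpa using this
  rw [sum_congr rfl this]
  simp

open Finset in
lemma sum_mul_fejerSum_mul_cos (M Q : ℕ) (N : ℝ) (g : ℕ → ℝ) :
    ∑ j ∈ range Q, g j * (fejerSum M (2 * Real.pi * j / Q) *
      Real.cos (N * (2 * Real.pi * j / Q))) =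
    ∑ k ∈ range M, ∑ l ∈ range M, ∑ j ∈ range Q,
      g j * Real.cos ((N + k - l) * (2 * Real.pi * j / Q)) := by
  simp only [fejerSum_mul_cos, mul_sum]
  rw [sum_comm]
  refine sum_congr rfl fun k _ => ?_
  rw [sum_comm]

lemma sin_half_sq (j Q : ℝ) :
    Real.sin (Real.pi * j / Q) ^ 2 = 1 / 2 * (1 - Real.cos (2 * Real.pi * j / Q)) := by
  rw [show 2 * Real.pi * j / Q = 2 * (Real.pi * j / Q) by ring, Real.cos_two_mul,
    Real.sin_sq]
  ring

open Finset in
lemma sum_sin_pow_mul_fejerSum_mul_cos {M l : ℕ} (hl : l < M) :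
    ∑ j ∈ range (4 * M), Real.sin (Real.pi * j / (4 * M : ℕ)) ^ (2 * l) *
      (fejerSum M (2 * Real.pi * j / (4 * M : ℕ)) *
        Real.cos ((2 * M : ℕ) * (2 * Real.pi * j / (4 * M : ℕ)))) = 0 := by
  rw [sum_mul_fejerSum_mul_cos M (4 * M) _
    (fun j => Real.sin (Real.pi * j / (4 * M : ℕ)) ^ (2 * l))]
  refine sum_eq_zero fun k hk => sum_eq_zero fun i hi => ?_
  simp only [mem_range] at hk hi
  have := sum_pow_mul_cos_eq_zero (Q := 4 * M) l (2 * M + k - i) (by omega) (by push_cast; omega)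
  simp only [pow_mul, sin_half_sq, mul_pow, mul_assoc] at this ⊢
  rw [← mul_sum]
  push_cast at this ⊢
  rw [this, mul_zero]

open Finset in
lemma sum_sin_mul_fejerSum_mul_cos_le {M : ℕ} (hM : 0 < M) :
    ∑ j ∈ range (4 * M), Real.sin (Real.pi * j / (4 * M : ℕ)) *
      (fejerSum M (2 * Real.pi * j / (4 * M : ℕ)) *
        Real.cos ((2 * M : ℕ) * (2 * Real.pi * j / (4 * M : ℕ)))) ≤
      -(M / 25) := by
  rw [sum_mul_fejerSum_mul_cos M (4 * M) _ (fun j => Real.sin (Real.pi * j / (4 * M : ℕ)))]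
  have hM0 : (0 : ℝ) < M := by exact_mod_cast hM
  have hpi := Real.pi_pos
  have hpi2 : Real.pi ^ 2 ≤ 100 / 9 := by nlinarith [Real.pi_lt_d2]
  have h : ∀ k ∈ range M, ∀ i ∈ range M, ∑ j ∈ range (4 * M),
      Real.sin (Real.pi * j / (4 * M : ℕ)) *
        Real.cos (((2 * M : ℕ) + k - i) * (2 * Real.pi * j / (4 * M : ℕ))) ≤ -(1 / (25 * M)) := by
    intro k hk i hi
    simp only [mem_range] at hk hi
    have h1 := sum_sin_half_mul_cos_le (n := 2 * M + k - i) (Q := 4 * M) (by omega) (by omega)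
    have e : ((2 * M + k - i : ℕ) : ℝ) = (2 * M : ℕ) + k - i := by
      rw [Nat.cast_sub (by omega)]; push_cast; ring
    have hle : ((2 * M + k - i : ℕ) : ℝ) ≤ 3 * M := by
      have : 2 * M + k - i ≤ 3 * M := by omega
      exact_mod_cast this
    have hpos : (0 : ℝ) < ((2 * M + k - i : ℕ) : ℝ) := by
      have : 0 < 2 * M + k - i := by omega
      exact_mod_cast this
    rw [e] at h1
    refine h1.trans (neg_le_neg ?_)
    rw [← e, div_le_div_iff₀ (by positivity) (by positivity)]
    have : Real.pi ^ 2 * ((2 * M + k - i : ℕ) : ℝ) ^ 2 ≤ 100 / 9 * (3 * M) ^ 2 := by gcongr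
    push_cast at this ⊢
    nlinarith
  calc _ ≤ ∑ k ∈ range M, ∑ i ∈ range M, -(1 / (25 * (M : ℝ))) :=
        sum_le_sum fun k hk => sum_le_sum fun i hi => h k hk i hi
    _ = _ := by
      simp only [sum_const, card_range, nsmul_eq_mul]
      field_simp

open Finset in
/-- Two symmetric priors on `[-1, 1]` whose first `2 * M` moments agree, but whose first absolute
moments differ by at least a constant multiple of `1 / M`. -/
lemma exists_moment_matching {M : ℕ} (hM : 0 < M) :
    ∃ x w₀ w₁ : Bool × Fin (4 * M) → ℝ,
      (∀ a, |x a| ≤ 1) ∧ (∀ a, 0 ≤ w₀ a) ∧ (∀ a, 0 ≤ w₁ a) ∧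
      ∑ a, w₀ a = 1 ∧ ∑ a, w₁ a = 1 ∧
      (∀ k < 2 * M, ∑ a, w₀ a * x a ^ k = ∑ a, w₁ a * x a ^ k) ∧
      1 / (50 * (M : ℝ)) ≤ ∑ a, w₁ a * |x a| - ∑ a, w₀ a * |x a| := by
  have hM0 : (0 : ℝ) < M := by exact_mod_cast hM
  have hpi := Real.pi_pos
  let t : ℕ → ℝ := fun j => Real.sin (Real.pi * j / (4 * M : ℕ))
  let F : ℕ → ℝ := fun j => fejerSum M (2 * Real.pi * j / (4 * M : ℕ))
  let C : ℕ → ℝ := fun j => Real.cos ((2 * M : ℕ) * (2 * Real.pi * j / (4 * M : ℕ)))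
  let sg : Bool → ℝ := fun s => if s then 1 else -1
  have hF : ∀ j, 0 ≤ F j := fun j => fejerSum_nonneg _ _
  have ht0 : ∀ j : Fin (4 * M), 0 ≤ t j := by
    intro j
    have hj : ((j : ℕ) : ℝ) ≤ ((4 * M : ℕ) : ℝ) := by exact_mod_cast j.2.le
    have hpos : (0 : ℝ) < ((4 * M : ℕ) : ℝ) := by exact_mod_cast (by omega : 0 < 4 * M)
    apply Real.sin_nonneg_of_nonneg_of_le_pi (by positivity)
    rw [div_le_iff₀ hpos]
    gcongr
  have hsumF : ∑ j ∈ range (4 * M), F j = 4 * M ^ 2 := by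
    have := sum_fejerSum (M := M) (Q := 4 * M) (by omega)
    simp only [F, this]
    push_cast
    ring
  have hFC : ∀ l < M, ∑ j ∈ range (4 * M), t j ^ (2 * l) * (F j * C j) = 0 := fun l hl =>
    sum_sin_pow_mul_fejerSum_mul_cos hl
  have hFC1 : ∑ j ∈ range (4 * M), t j * (F j * C j) ≤ -(M / 25) :=
    sum_sin_mul_fejerSum_mul_cos_le hM
  have hFC0 : ∑ j ∈ range (4 * M), F j * C j = 0 := by simpa using hFC 0 hM
  have hsum : ∀ (e : ℝ) (h : Bool × Fin (4 * M) → ℝ) (g : ℕ → ℝ),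
      (∀ j : Fin (4 * M), h (true, j) + h (false, j) = 2 * g j) →
      ∑ a : Bool × Fin (4 * M), (F a.2 * (1 + e * C a.2) / (8 * M ^ 2)) * h a =
        (∑ j ∈ range (4 * M), g j * F j + e * ∑ j ∈ range (4 * M), g j * (F j * C j)) /
          (4 * M ^ 2) := by
    intro e h g hg
    rw [Fintype.sum_prod_type, Fintype.sum_bool, ← sum_add_distrib, mul_sum, ← sum_add_distrib,
      sum_div, ← Fin.sum_univ_eq_sum_range
        (fun j => (g j * F j + e * (g j * (F j * C j))) / (4 * (M : ℝ) ^ 2))]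
    refine sum_congr rfl fun j _ => ?_
    simp only
    rw [← mul_add, hg]
    field_simp
    ring
  have hsg : ∀ s, |sg s| = 1 := by intro s; cases s <;> simp [sg]
  have hC1 : ∀ j, |C j| ≤ 1 := fun j => Real.abs_cos_le_one _
  have hM2 : (4 * (M : ℝ) ^ 2) ≠ 0 := by positivity
  refine ⟨fun a => sg a.1 * t a.2, fun a => F a.2 * (1 + 1 * C a.2) / (8 * M ^ 2),
    fun a => F a.2 * (1 + (-1) * C a.2) / (8 * M ^ 2), ?_, ?_, ?_, ?_, ?_, ?_, ?_⟩
  · intro a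
    rw [abs_mul, hsg, one_mul]
    exact Real.abs_sin_le_one _
  · intro a
    have := neg_le_of_abs_le (hC1 a.2)
    have := hF a.2
    apply div_nonneg (mul_nonneg (hF _) (by linarith)) (by positivity)
  · intro a
    have := le_of_abs_le (hC1 a.2)
    have := hF a.2
    apply div_nonneg (mul_nonneg (hF _) (by linarith)) (by positivity)
  · have := hsum 1 (fun _ => 1) (fun _ => 1) (by intro j; norm_num)
    simp only [mul_one, one_mul] at this ⊢
    rw [this, hsumF, hFC0, add_zero, div_self hM2]
  · have := hsum (-1) (fun _ => 1) (fun _ => 1) (by intro j; norm_num)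
    simp only [mul_one, one_mul] at this ⊢
    rw [this, hsumF, hFC0, mul_zero, add_zero, div_self hM2]
  · intro k hk
    simp only
    rcases Nat.even_or_odd' k with ⟨l, rfl | rfl⟩
    · have hg : ∀ j : Fin (4 * M), (sg true * t j) ^ (2 * l) + (sg false * t j) ^ (2 * l) =
          2 * t j ^ (2 * l) := by
        intro j
        simp only [sg, pow_mul]
        norm_num
        ring
      rw [hsum 1 (fun a => (sg a.1 * t a.2) ^ (2 * l)) (fun j => t j ^ (2 * l)) hg,
        hsum (-1) (fun a => (sg a.1 * t a.2) ^ (2 * l)) (fun j => t j ^ (2 * l)) hg,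
        hFC l (by omega)]
      ring
    · have hg : ∀ j : Fin (4 * M),
          (sg true * t j) ^ (2 * l + 1) + (sg false * t j) ^ (2 * l + 1) = 2 * (0 : ℝ) := by
        intro j
        simp only [sg, pow_succ, pow_mul]
        norm_num
      rw [hsum 1 (fun a => (sg a.1 * t a.2) ^ (2 * l + 1)) (fun j => 0) hg,
        hsum (-1) (fun a => (sg a.1 * t a.2) ^ (2 * l + 1)) (fun j => 0) hg]
      simp
  · have hg : ∀ j : Fin (4 * M), |sg true * t j| + |sg false * t j| = 2 * t j := by
      intro j
      rw [abs_mul, abs_mul, hsg, hsg, abs_of_nonneg (ht0 j)]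
      ring
    simp only
    rw [hsum 1 (fun a => |sg a.1 * t a.2|) t hg, hsum (-1) (fun a => |sg a.1 * t a.2|) t hg,
      ← sub_div, div_le_div_iff₀ (by positivity) (by positivity)]
    nlinarith

open Finset in
/-- A second-moment bound for the difference of two mixtures of `n`-fold product measures with
densities `q * (1 + ζ * y c)` whose mixing measures share their first `K` moments. -/
lemma abs_sum_mixture_le {α ι : Type*} [Fintype α] [Fintype ι] {q ζ : α → ℝ} {v y : ι → ℝ}
    {n K : ℕ} {R κ δ : ℝ} {ψ : (Fin n → α) → ℝ} (hq : ∀ x, 0 ≤ q x) (hq1 : ∑ x, q x = 1)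
    (hζ : ∑ x, q x * ζ x = 0) (hκ : ∑ x, q x * ζ x ^ 2 ≤ κ) (hδ : 0 ≤ δ) (hy : ∀ c, |y c| ≤ δ)
    (hv : ∑ c, |v c| ≤ 2) (hK : ∀ k < K, ∑ c, v c * y c ^ k = 0) (hR : 1 ≤ R)
    (hψ : ∀ ω, |ψ ω| ≤ 1) :
    |∑ ω, ψ ω * ∑ c, v c * ∏ l, (q (ω l) * (1 + ζ (ω l) * y c))| ≤
      √(4 / R ^ K * (1 + R * κ * δ ^ 2) ^ n) := by
  set κ' := ∑ x, q x * ζ x ^ 2 with hκ'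
  have hκ0 : 0 ≤ κ' := sum_nonneg fun x _ => mul_nonneg (hq x) (sq_nonneg _)
  let Q : (Fin n → α) → ℝ := fun ω => ∏ l, q (ω l)
  let H : (Fin n → α) → ℝ := fun ω => ∑ c, v c * ∏ l, (1 + ζ (ω l) * y c)
  have hQ : ∀ ω, 0 ≤ Q ω := fun ω => prod_nonneg fun l _ => hq _
  have hQ1 : ∑ ω, Q ω = 1 := by
    rw [← Fintype.sum_pow, hq1, one_pow]
  have hsum : ∑ ω, ψ ω * ∑ c, v c * ∏ l, (q (ω l) * (1 + ζ (ω l) * y c)) =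
      ∑ ω, ψ ω * (Q ω * H ω) := by
    refine sum_congr rfl fun ω _ => ?_
    simp only [Q, H, mul_sum, prod_mul_distrib]
    refine sum_congr rfl fun c _ => ?_
    ring
  have hQH : ∑ ω, Q ω * H ω ^ 2 = ∑ c, ∑ c', v c * v c' * (1 + κ' * (y c * y c')) ^ n := by
    have h1 : ∀ c c', (1 + κ' * (y c * y c')) ^ n =
        ∑ ω : Fin n → α, Q ω * ((∏ l, (1 + ζ (ω l) * y c)) * ∏ l, (1 + ζ (ω l) * y c')) := by
      intro c c'
      have : 1 + κ' * (y c * y c') =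
          ∑ x, q x * ((1 + ζ x * y c) * (1 + ζ x * y c')) := by
        have : ∀ x, q x * ((1 + ζ x * y c) * (1 + ζ x * y c')) =
            q x + (q x * ζ x) * (y c + y c') + q x * ζ x ^ 2 * (y c * y c') := by
          intro x; ring
        simp only [this, sum_add_distrib, ← sum_mul, hq1, hζ, ← hκ']
        ring
      rw [this, Fintype.sum_pow]
      refine sum_congr rfl fun ω _ => ?_
      rw [prod_mul_distrib, prod_mul_distrib]
    simp only [h1, mul_sum, H, sq, sum_mul]
    rw [sum_comm]
    refine sum_congr rfl fun c _ => ?_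
    rw [sum_comm]
    refine sum_congr rfl fun c' _ => ?_
    refine sum_congr rfl fun ω _ => ?_
    ring
  have hQH2 : ∑ ω, Q ω * H ω ^ 2 =
      ∑ k ∈ range (n + 1), κ' ^ k * (n.choose k) * (∑ c, v c * y c ^ k) ^ 2 := by
    rw [hQH]
    have : ∀ c c', (1 + κ' * (y c * y c')) ^ n =
        ∑ k ∈ range (n + 1), κ' ^ k * (n.choose k) * (y c ^ k * y c' ^ k) := by
      intro c c'
      rw [add_comm, add_pow]
      refine sum_congr rfl fun k _ => ?_
      rw [mul_pow, mul_pow]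
      ring
    simp only [this, mul_sum, sq, sum_mul]
    rw [sum_comm]
    conv_lhs =>
      enter [2, c]
      rw [sum_comm]
    rw [sum_comm]
    refine sum_congr rfl fun k _ => ?_
    rw [sum_comm]
    refine sum_congr rfl fun c _ => ?_
    refine sum_congr rfl fun c' _ => ?_
    ring
  have hbd : ∑ ω, Q ω * H ω ^ 2 ≤ 4 / R ^ K * (1 + R * κ * δ ^ 2) ^ n := by
    have hRp : 0 < R := by linarith
    have step : (4 / R ^ K * (1 + R * κ' * δ ^ 2) ^ n) ≤
        4 / R ^ K * (1 + R * κ * δ ^ 2) ^ n := by gcongr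
    refine le_trans ?_ step
    rw [hQH2, add_comm 1, add_pow, mul_sum]
    refine sum_le_sum fun k _ => ?_
    rcases lt_or_ge k K with hk | hk
    · rw [hK k hk]
      simp only [ne_eq, OfNat.ofNat_ne_zero, not_false_eq_true, zero_pow, mul_zero]
      positivity
    · have habs : |∑ c, v c * y c ^ k| ≤ 2 * δ ^ k := by
        calc _ ≤ ∑ c, |v c * y c ^ k| := abs_sum_le_sum_abs _ _
          _ ≤ ∑ c, |v c| * δ ^ k := by
            refine sum_le_sum fun c _ => ?_
            rw [abs_mul, abs_pow]
            gcongr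
            exact hy c
          _ ≤ _ := by
            rw [← sum_mul]
            gcongr
      have hsq : (∑ c, v c * y c ^ k) ^ 2 ≤ 4 * (δ ^ 2) ^ k := by
        calc _ = |∑ c, v c * y c ^ k| ^ 2 := (sq_abs _).symm
          _ ≤ (2 * δ ^ k) ^ 2 := by gcongr
          _ = _ := by ring
      have hRK : R ^ K ≤ R ^ k := pow_le_pow_right₀ hR hk
      calc κ' ^ k * (n.choose k) * (∑ c, v c * y c ^ k) ^ 2
          ≤ κ' ^ k * (n.choose k) * (4 * (δ ^ 2) ^ k) := by gcongr
        _ = 4 / R ^ K * R ^ K * (κ' ^ k * (n.choose k) * (δ ^ 2) ^ k) := by field_simp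
        _ ≤ 4 / R ^ K * R ^ k * (κ' ^ k * (n.choose k) * (δ ^ 2) ^ k) := by gcongr
        _ = _ := by rw [mul_pow, mul_pow]; ring
  rw [hsum]
  apply Real.abs_le_sqrt
  have hcs := sum_sq_le_sum_mul_sum_of_sq_le_mul univ (r := fun ω => ψ ω * (Q ω * H ω))
    (f := Q) (g := fun ω => Q ω * H ω ^ 2) (fun ω _ => hQ ω)
    (fun ω _ => mul_nonneg (hQ ω) (sq_nonneg _)) (fun ω _ => by
      have h1 : ψ ω ^ 2 ≤ 1 := (sq_le_one_iff_abs_le_one _).mpr (hψ ω)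
      have h2 := mul_le_mul_of_nonneg_right h1 (sq_nonneg (Q ω * H ω))
      rw [mul_pow]
      linarith)
  refine hcs.trans ?_
  rw [hQ1, one_mul]
  exact hbd

lemma Fin.sum_pi_succ {ι : Type*} [Fintype ι] {m : ℕ} (f : (Fin (m + 1) → ι) → ℝ) :
    ∑ a, f a = ∑ c, ∑ a : Fin m → ι, f (Fin.cons c a) := by
  rw [← (Fin.consEquiv fun _ : Fin (m + 1) => ι).sum_comp, Fintype.sum_prod_type]
  rfl

lemma sum_prod_eq_one {ι : Type*} [Fintype ι] {w : ι → ℝ} (h1 : ∑ c, w c = 1) (m : ℕ) :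
    ∑ a : Fin m → ι, ∏ b, w (a b) = 1 := by
  rw [← Fintype.sum_pow, h1, one_pow]

/-- Replacing the coordinates of a product prior one at a time. -/
lemma abs_sum_prod_sub_prod_mul_le {ι : Type*} [Fintype ι] {w₀ w₁ : ι → ℝ}
    (h0 : ∀ c, 0 ≤ w₀ c) (h1 : ∀ c, 0 ≤ w₁ c) (hs0 : ∑ c, w₀ c = 1) (hs1 : ∑ c, w₁ c = 1)
    {η : ℝ} {m : ℕ} : ∀ Φ : (Fin m → ι) → ℝ,
    (∀ a b, |∑ c, (w₁ c - w₀ c) * Φ (Function.update a b c)| ≤ η) →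
    |∑ a, (∏ b, w₁ (a b) - ∏ b, w₀ (a b)) * Φ a| ≤ m * η := by
  induction m with
  | zero => intro Φ _; simp
  | succ m ih =>
    intro Φ h
    have key : ∑ a, (∏ b, w₁ (a b) - ∏ b, w₀ (a b)) * Φ a =
        ∑ c, w₁ c * ∑ a : Fin m → ι, (∏ b, w₁ (a b) - ∏ b, w₀ (a b)) * Φ (Fin.cons c a) +
        ∑ a : Fin m → ι, (∏ b, w₀ (a b)) * ∑ c, (w₁ c - w₀ c) * Φ (Fin.cons c a) := by
      rw [Fin.sum_pi_succ]
      simp only [Fin.prod_univ_succ, Fin.cons_zero, Fin.cons_succ, Finset.mul_sum]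
      rw [Finset.sum_comm (f := fun (a : Fin m → ι) c => _), ← Finset.sum_add_distrib]
      refine Finset.sum_congr rfl fun c _ => ?_
      rw [← Finset.sum_add_distrib]
      refine Finset.sum_congr rfl fun a _ => ?_
      ring
    rw [key]
    have i1 : |∑ c, w₁ c * ∑ a : Fin m → ι,
        (∏ b, w₁ (a b) - ∏ b, w₀ (a b)) * Φ (Fin.cons c a)| ≤ m * η := by
      calc _ ≤ ∑ c, |w₁ c * ∑ a : Fin m → ι,
            (∏ b, w₁ (a b) - ∏ b, w₀ (a b)) * Φ (Fin.cons c a)| :=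
            Finset.abs_sum_le_sum_abs _ _
        _ ≤ ∑ c, w₁ c * (m * η) := by
          refine Finset.sum_le_sum fun c _ => ?_
          rw [abs_mul, abs_of_nonneg (h1 c)]
          refine mul_le_mul_of_nonneg_left ?_ (h1 c)
          refine ih (fun a => Φ (Fin.cons c a)) fun a b => ?_
          have := h (Fin.cons c a) b.succ
          simpa only [Fin.cons_update] using this
        _ = m * η := by rw [← Finset.sum_mul, hs1, one_mul]
    have i2 : |∑ a : Fin m → ι, (∏ b, w₀ (a b)) *
        ∑ c, (w₁ c - w₀ c) * Φ (Fin.cons c a)| ≤ η := by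
      calc _ ≤ ∑ a : Fin m → ι, |(∏ b, w₀ (a b)) *
            ∑ c, (w₁ c - w₀ c) * Φ (Fin.cons c a)| := Finset.abs_sum_le_sum_abs _ _
        _ ≤ ∑ a : Fin m → ι, (∏ b, w₀ (a b)) * η := by
          refine Finset.sum_le_sum fun a _ => ?_
          have hp : 0 ≤ ∏ b, w₀ (a b) := Finset.prod_nonneg fun b _ => h0 _
          rw [abs_mul, abs_of_nonneg hp]
          refine mul_le_mul_of_nonneg_left ?_ hp
          rcases isEmpty_or_nonempty ι with hι | ⟨⟨d⟩⟩
          · simp at hs0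
          · have := h (Fin.cons d a) 0
            simpa only [Fin.update_cons_zero] using this
        _ = η := by rw [← Finset.sum_mul, sum_prod_eq_one hs0, one_mul]
    calc _ ≤ _ := abs_add_le _ _
      _ ≤ m * η + η := add_le_add i1 i2
      _ = _ := by push_cast; ring

/-- Exponential moment bound for sums of independent variables bounded by one. -/
lemma sum_prod_mul_exp_le {ι : Type*} [Fintype ι] {w f : ι → ℝ} (h0 : ∀ c, 0 ≤ w c)
    (h1 : ∑ c, w c = 1) (hf : ∀ c, |f c| ≤ 1) (hf0 : ∑ c, w c * f c = 0) {s : ℝ}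
    (hs0 : 0 ≤ s) (hs : s ≤ 2) (m : ℕ) :
    ∑ a : Fin m → ι, (∏ b, w (a b)) * Real.exp (s / 2 * ∑ b, (f (a b) - s)) ≤
      Real.exp (-(m * s ^ 2 / 4)) := by
  have e : ∀ a : Fin m → ι, (∏ b, w (a b)) * Real.exp (s / 2 * ∑ b, (f (a b) - s)) =
      ∏ b, (w (a b) * Real.exp (s / 2 * (f (a b) - s))) := by
    intro a
    rw [Finset.prod_mul_distrib, Finset.mul_sum, Real.exp_sum]
  simp only [e]
  rw [← Fintype.sum_pow (fun c => w c * Real.exp (s / 2 * (f c - s)))]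
  have hb : ∑ c, w c * Real.exp (s / 2 * (f c - s)) ≤ Real.exp (-(s ^ 2 / 4)) := by
    have h2 : ∀ c, Real.exp (s / 2 * (f c - s)) ≤
        Real.exp (-(s ^ 2 / 2)) * (1 + s / 2 * f c + (s / 2) ^ 2) := by
      intro c
      have hle : |s / 2 * f c| ≤ 1 := by
        rw [abs_mul, abs_of_nonneg (by linarith)]
        have := hf c
        nlinarith [abs_nonneg (f c)]
      have h3 := le_of_abs_le (Real.abs_exp_sub_one_sub_id_le hle)
      have h4 : (s / 2 * f c) ^ 2 ≤ (s / 2) ^ 2 := by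
        have : f c ^ 2 ≤ 1 := (sq_le_one_iff_abs_le_one _).mpr (hf c)
        rw [mul_pow]
        nlinarith [sq_nonneg (s / 2)]
      rw [show s / 2 * (f c - s) = -(s ^ 2 / 2) + s / 2 * f c by ring, Real.exp_add]
      refine mul_le_mul_of_nonneg_left ?_ (Real.exp_pos _).le
      linarith
    calc _ ≤ ∑ c, w c * (Real.exp (-(s ^ 2 / 2)) * (1 + s / 2 * f c + (s / 2) ^ 2)) :=
          Finset.sum_le_sum fun c _ => mul_le_mul_of_nonneg_left (h2 c) (h0 c)
      _ = Real.exp (-(s ^ 2 / 2)) * (1 + (s / 2) ^ 2) := by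
        have : ∀ c, w c * (Real.exp (-(s ^ 2 / 2)) * (1 + s / 2 * f c + (s / 2) ^ 2)) =
          Real.exp (-(s ^ 2 / 2)) * (w c * (1 + (s / 2) ^ 2) + s / 2 * (w c * f c)) := by
          intro c; ring
        simp only [this]
        rw [← Finset.mul_sum, Finset.sum_add_distrib, ← Finset.sum_mul, ← Finset.mul_sum, h1, hf0]
        ring
      _ ≤ Real.exp (-(s ^ 2 / 2)) * Real.exp ((s / 2) ^ 2) := by
        refine mul_le_mul_of_nonneg_left ?_ (Real.exp_pos _).le
        linarith [Real.add_one_le_exp ((s / 2) ^ 2)]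
      _ = _ := by rw [← Real.exp_add]; congr 1; ring
  calc _ ≤ Real.exp (-(s ^ 2 / 4)) ^ m := by
        refine pow_le_pow_left₀ (Finset.sum_nonneg fun c _ => ?_) hb m
        exact mul_nonneg (h0 c) (Real.exp_pos _).le
    _ = _ := by rw [← Real.exp_nat_mul]; congr 1; ring

/-- The largest type I error of a test. -/
noncomputable def nullError (r n12 n23 n13 : ℕ) (ψ : SampleSpace r n12 n23 n13 → ℝ) : ℝ :=
  sSup {x | ∃ p12 p23 p13, ProbTriple r 2 2 p12 p23 p13 ∧
    CompatTriple r 2 2 p12 p23 p13 ∧ x = expTest r n12 n23 n13 ψ p12 p23 p13}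

/-- The largest type II error of a test over `ρ`-incompatible families. -/
noncomputable def altError (r n12 n23 n13 : ℕ) (ρ : ℝ) (ψ : SampleSpace r n12 n23 n13 → ℝ) : ℝ :=
  sSup {x | ∃ p12 p23 p13, ProbTriple r 2 2 p12 p23 p13 ∧
    ρ ≤ RTriple r 2 2 p12 p23 p13 ∧ x = expTest r n12 n23 n13 (fun ω => 1 - ψ ω) p12 p23 p13}

lemma minimaxRisk_eq (r n12 n23 n13 : ℕ) (ρ : ℝ) :
    minimaxRisk r n12 n23 n13 ρ =
      sInf {t : ℝ | ∃ ψ : SampleSpace r n12 n23 n13 → ℝ, (∀ ω, ψ ω ∈ Set.Icc (0 : ℝ) 1) ∧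
        t = nullError r n12 n23 n13 ψ + altError r n12 n23 n13 ρ ψ} := rfl

section expTest

variable {r n12 n23 n13 : ℕ} {p12 : Fin r → Fin 2 → ℝ} {p23 : Fin 2 → Fin 2 → ℝ}
  {p13 : Fin r → Fin 2 → ℝ}

lemma sum_prod_uncurry_eq_one {α β : Type*} [Fintype α] [Fintype β] {p : α → β → ℝ}
    (h : ∑ i, ∑ j, p i j = 1) (n : ℕ) :
    ∑ ω : Fin n → α × β, ∏ l, p (ω l).1 (ω l).2 = 1 :=
  sum_prod_eq_one (w := fun x : α × β => p x.1 x.2) (by rw [Fintype.sum_prod_type]; exact h) n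

lemma expTest_one (h : ProbTriple r 2 2 p12 p23 p13) :
    expTest r n12 n23 n13 (fun _ => 1) p12 p23 p13 = 1 := by
  obtain ⟨_, _, _, h1, h2, h3⟩ := h
  simp only [expTest, one_mul]
  rw [Fintype.sum_prod_type]
  simp only [Fintype.sum_prod_type (γ := ℝ), ← Finset.mul_sum, sum_prod_uncurry_eq_one h3, mul_one,
    sum_prod_uncurry_eq_one h2, sum_prod_uncurry_eq_one h1]

lemma expTest_nonneg (h : ProbTriple r 2 2 p12 p23 p13) {ψ : SampleSpace r n12 n23 n13 → ℝ}
    (hψ : ∀ ω, 0 ≤ ψ ω) : 0 ≤ expTest r n12 n23 n13 ψ p12 p23 p13 := by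
  obtain ⟨h1, h2, h3, _⟩ := h
  refine Finset.sum_nonneg fun ω _ => mul_nonneg (hψ ω) ?_
  exact mul_nonneg (mul_nonneg (Finset.prod_nonneg fun _ _ => h1 _ _)
    (Finset.prod_nonneg fun _ _ => h2 _ _)) (Finset.prod_nonneg fun _ _ => h3 _ _)

lemma expTest_one_sub (h : ProbTriple r 2 2 p12 p23 p13) (ψ : SampleSpace r n12 n23 n13 → ℝ) :
    expTest r n12 n23 n13 (fun ω => 1 - ψ ω) p12 p23 p13 =
      1 - expTest r n12 n23 n13 ψ p12 p23 p13 := by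
  have h1 := expTest_one (n12 := n12) (n23 := n23) (n13 := n13) h
  simp only [expTest] at h1
  simp only [expTest, sub_mul, Finset.sum_sub_distrib, h1]

lemma expTest_le_one (h : ProbTriple r 2 2 p12 p23 p13) {ψ : SampleSpace r n12 n23 n13 → ℝ}
    (hψ : ∀ ω, ψ ω ≤ 1) : expTest r n12 n23 n13 ψ p12 p23 p13 ≤ 1 := by
  have := expTest_nonneg (ψ := fun ω => 1 - ψ ω) h (fun ω => sub_nonneg.mpr (hψ ω))
  rw [expTest_one_sub h] at this
  linarith

/-- Integrating out all samples but the first. -/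
lemma exists_expTest_eq_sum_fst (h2 : ∀ j k, 0 ≤ p23 j k) (h3 : ∀ i k, 0 ≤ p13 i k)
    (s2 : ∑ j, ∑ k, p23 j k = 1) (s3 : ∑ i, ∑ k, p13 i k = 1)
    {ψ : SampleSpace r n12 n23 n13 → ℝ} (hψ : ∀ ω, ψ ω ∈ Set.Icc (0 : ℝ) 1) :
    ∃ φ : (Fin n12 → Fin r × Fin 2) → ℝ, (∀ ω, |φ ω| ≤ 1) ∧
      ∀ p12, expTest r n12 n23 n13 ψ p12 p23 p13 =
        ∑ ω, φ ω * ∏ l, p12 (ω l).1 (ω l).2 := by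
  let L : (Fin n23 → Fin 2 × Fin 2) × (Fin n13 → Fin r × Fin 2) → ℝ := fun x =>
    (∏ l, p23 (x.1 l).1 (x.1 l).2) * ∏ l, p13 (x.2 l).1 (x.2 l).2
  have hL : ∀ x, 0 ≤ L x := fun x => mul_nonneg (Finset.prod_nonneg fun _ _ => h2 _ _)
    (Finset.prod_nonneg fun _ _ => h3 _ _)
  have hL1 : ∑ x, L x = 1 := by
    simp only [L, Fintype.sum_prod_type (γ := ℝ), ← Finset.mul_sum, sum_prod_uncurry_eq_one s3,
      mul_one, sum_prod_uncurry_eq_one s2]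
  refine ⟨fun ω => ∑ x, ψ (ω, x) * L x, fun ω => ?_, fun p12 => ?_⟩
  · rw [abs_of_nonneg (Finset.sum_nonneg fun x _ => mul_nonneg (hψ _).1 (hL x)), ← hL1]
    exact Finset.sum_le_sum fun x _ => mul_le_of_le_one_left (hL x) (hψ _).2
  · rw [expTest, Fintype.sum_prod_type]
    refine Finset.sum_congr rfl fun ω _ => ?_
    rw [Finset.sum_mul]
    refine Finset.sum_congr rfl fun x _ => ?_
    simp only [L]
    ring

/-- Integrating out all samples but the second. -/
lemma exists_expTest_eq_sum_snd (h1 : ∀ i j, 0 ≤ p12 i j) (h3 : ∀ i k, 0 ≤ p13 i k)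
    (s1 : ∑ i, ∑ j, p12 i j = 1) (s3 : ∑ i, ∑ k, p13 i k = 1)
    {ψ : SampleSpace r n12 n23 n13 → ℝ} (hψ : ∀ ω, ψ ω ∈ Set.Icc (0 : ℝ) 1) :
    ∃ φ : (Fin n23 → Fin 2 × Fin 2) → ℝ, (∀ ω, |φ ω| ≤ 1) ∧
      ∀ p23, expTest r n12 n23 n13 ψ p12 p23 p13 =
        ∑ ω, φ ω * ∏ l, p23 (ω l).1 (ω l).2 := by
  let L : (Fin n12 → Fin r × Fin 2) × (Fin n13 → Fin r × Fin 2) → ℝ := fun x =>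
    (∏ l, p12 (x.1 l).1 (x.1 l).2) * ∏ l, p13 (x.2 l).1 (x.2 l).2
  have hL : ∀ x, 0 ≤ L x := fun x => mul_nonneg (Finset.prod_nonneg fun _ _ => h1 _ _)
    (Finset.prod_nonneg fun _ _ => h3 _ _)
  have hL1 : ∑ x, L x = 1 := by
    simp only [L, Fintype.sum_prod_type (γ := ℝ), ← Finset.mul_sum, sum_prod_uncurry_eq_one s3,
      mul_one, sum_prod_uncurry_eq_one s1]
  refine ⟨fun ω => ∑ x, ψ (x.1, ω, x.2) * L x, fun ω => ?_, fun p23 => ?_⟩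
  · rw [abs_of_nonneg (Finset.sum_nonneg fun x _ => mul_nonneg (hψ _).1 (hL x)), ← hL1]
    exact Finset.sum_le_sum fun x _ => mul_le_of_le_one_left (hL x) (hψ _).2
  · simp only [expTest, Fintype.sum_prod_type (γ := ℝ), Finset.sum_mul]
    rw [Finset.sum_comm]
    refine Finset.sum_congr rfl fun ω _ => ?_
    refine Finset.sum_congr rfl fun x _ => ?_
    refine Finset.sum_congr rfl fun y _ => ?_
    simp only [L]
    ring

lemma expTest_swap (ψ : SampleSpace r n12 n23 n13 → ℝ) :
    expTest r n13 n23 n12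
        (fun ω => ψ (ω.2.2, fun l => (ω.2.1 l).swap, ω.1)) p13 (fun k j => p23 j k) p12 =
      expTest r n12 n23 n13 ψ p12 p23 p13 := by
  let Φ : SampleSpace r n13 n23 n12 ≃ SampleSpace r n12 n23 n13 :=
    { toFun := fun ω => (ω.2.2, fun l => (ω.2.1 l).swap, ω.1)
      invFun := fun ω => (ω.2.2, fun l => (ω.2.1 l).swap, ω.1)
      left_inv := fun _ => rfl
      right_inv := fun _ => rfl }
  simp only [expTest]
  rw [← Φ.sum_comp]
  refine Finset.sum_congr rfl fun ω _ => ?_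
  simp only [Φ, Equiv.coe_fn_mk, Prod.fst_swap, Prod.snd_swap]
  ring

end expTest

section Swap

variable {r s u : ℕ} {p12 : Fin r → Fin s → ℝ} {p23 : Fin s → Fin u → ℝ}
  {p13 : Fin r → Fin u → ℝ}

lemma ProbTriple.swap (h : ProbTriple r s u p12 p23 p13) :
    ProbTriple r u s p13 (fun k j => p23 j k) p12 := by
  obtain ⟨h1, h2, h3, s1, s2, s3⟩ := h
  exact ⟨h3, fun k j => h2 j k, h1, s3, by rw [Finset.sum_comm]; exact s2, s1⟩

lemma CompatTriple.swap (h : CompatTriple r s u p12 p23 p13) :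
    CompatTriple r u s p13 (fun k j => p23 j k) p12 := by
  obtain ⟨q, h0, hs, h1, h2, h3⟩ := h
  refine ⟨fun i k j => q i j k, fun i k j => h0 i j k, ?_, h3, fun k j => h2 j k, h1⟩
  rw [← hs]
  exact Finset.sum_congr rfl fun i _ => Finset.sum_comm

lemma RTriple_swap : RTriple r u s p13 (fun k j => p23 j k) p12 = RTriple r s u p12 p23 p13 := by
  simp only [RTriple]
  congr 1
  ext t
  constructor
  · rintro ⟨f12, f23, f13, h1, h2, h3, h, rfl⟩
    refine ⟨f13, fun j k => f23 k j, f12, h3, fun j k => h2 k j, h1, fun i j k => ?_, ?_⟩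
    · linarith [h i k j]
    · rw [Finset.sum_comm (f := fun (j : Fin s) (k : Fin u) => f23 k j * p23 j k)]
      ring
  · rintro ⟨f12, f23, f13, h1, h2, h3, h, rfl⟩
    refine ⟨f13, fun j k => f23 k j, f12, h3, fun j k => h2 k j, h1, fun i j k => ?_, ?_⟩
    · linarith [h i k j]
    · rw [Finset.sum_comm (f := fun (j : Fin u) (k : Fin s) => f23 k j * p23 k j)]
      ring

end Swap

lemma minimaxRisk_swap (r n12 n23 n13 : ℕ) (ρ : ℝ) :
    minimaxRisk r n13 n23 n12 ρ = minimaxRisk r n12 n23 n13 ρ := by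
  have key : ∀ {n12 n23 n13 : ℕ} (ψ : SampleSpace r n12 n23 n13 → ℝ),
      nullError r n13 n23 n12 (fun ω => ψ (ω.2.2, fun l => (ω.2.1 l).swap, ω.1)) =
        nullError r n12 n23 n13 ψ ∧
      altError r n13 n23 n12 ρ (fun ω => ψ (ω.2.2, fun l => (ω.2.1 l).swap, ω.1)) =
        altError r n12 n23 n13 ρ ψ := by
    intro n12 n23 n13 ψ
    constructor
    · simp only [nullError]
      congr 1
      ext t
      constructor
      · rintro ⟨p13, p32, p12, h, hc, rfl⟩
        exact ⟨p12, fun j k => p32 k j, p13, h.swap, hc.swap,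
          expTest_swap (p23 := fun j k => p32 k j) ψ⟩
      · rintro ⟨p12, p23, p13, h, hc, rfl⟩
        exact ⟨p13, fun k j => p23 j k, p12, h.swap, hc.swap, (expTest_swap ψ).symm⟩
    · simp only [altError]
      congr 1
      ext t
      constructor
      · rintro ⟨p13, p32, p12, h, hc, rfl⟩
        exact ⟨p12, fun j k => p32 k j, p13, h.swap, by rwa [RTriple_swap],
          expTest_swap (p23 := fun j k => p32 k j) (fun ω => 1 - ψ ω)⟩
      · rintro ⟨p12, p23, p13, h, hc, rfl⟩
        exact ⟨p13, fun k j => p23 j k, p12, h.swap, by rwa [RTriple_swap],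
          (expTest_swap (fun ω => 1 - ψ ω)).symm⟩
  rw [minimaxRisk_eq, minimaxRisk_eq]
  congr 1
  ext t
  constructor
  · rintro ⟨ψ, hψ, rfl⟩
    refine ⟨fun ω => ψ (ω.2.2, fun l => (ω.2.1 l).swap, ω.1), fun ω => hψ _, ?_⟩
    rw [(key ψ).1, (key ψ).2]
  · rintro ⟨ψ, hψ, rfl⟩
    refine ⟨fun ω => ψ (ω.2.2, fun l => (ω.2.1 l).swap, ω.1), fun ω => hψ _, ?_⟩
    rw [(key ψ).1, (key ψ).2]

lemma rhoStar_swap (r n12 n23 n13 : ℕ) : rhoStar r n13 n23 n12 = rhoStar r n12 n23 n13 := by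
  simp only [rhoStar, minimaxRisk_swap]

section RTriple

variable {r s u : ℕ} {p12 : Fin r → Fin s → ℝ} {p23 : Fin s → Fin u → ℝ}
  {p13 : Fin r → Fin u → ℝ}

lemma neg_one_le_sum_mul {α β : Type*} [Fintype α] [Fintype β] {f p : α → β → ℝ}
    (hf : ∀ i j, -1 ≤ f i j) (hp : ∀ i j, 0 ≤ p i j) (hs : ∑ i, ∑ j, p i j = 1) :
    -1 ≤ ∑ i, ∑ j, f i j * p i j := by
  rw [← hs, ← Finset.sum_neg_distrib]
  refine Finset.sum_le_sum fun i _ => ?_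
  rw [← Finset.sum_neg_distrib]
  refine Finset.sum_le_sum fun j _ => ?_
  nlinarith [hf i j, hp i j]

lemma ProbTriple.score_le_one (h : ProbTriple r s u p12 p23 p13)
    {f12 : Fin r → Fin s → ℝ} {f23 : Fin s → Fin u → ℝ} {f13 : Fin r → Fin u → ℝ}
    (h1 : ∀ i j, -1 ≤ f12 i j) (h2 : ∀ j k, -1 ≤ f23 j k) (h3 : ∀ i k, -1 ≤ f13 i k) :
    -(1 / 3) * ((∑ i, ∑ j, f12 i j * p12 i j) + (∑ j, ∑ k, f23 j k * p23 j k) +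
      (∑ i, ∑ k, f13 i k * p13 i k)) ≤ 1 := by
  obtain ⟨a1, a2, a3, s1, s2, s3⟩ := h
  linarith [neg_one_le_sum_mul h1 a1 s1, neg_one_le_sum_mul h2 a2 s2, neg_one_le_sum_mul h3 a3 s3]

lemma ProbTriple.score_le_RTriple (h : ProbTriple r s u p12 p23 p13)
    {f12 : Fin r → Fin s → ℝ} {f23 : Fin s → Fin u → ℝ} {f13 : Fin r → Fin u → ℝ}
    (h1 : ∀ i j, -1 ≤ f12 i j) (h2 : ∀ j k, -1 ≤ f23 j k) (h3 : ∀ i k, -1 ≤ f13 i k)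
    (hf : ∀ i j k, 0 ≤ f12 i j + f23 j k + f13 i k) :
    -(1 / 3) * ((∑ i, ∑ j, f12 i j * p12 i j) + (∑ j, ∑ k, f23 j k * p23 j k) +
      (∑ i, ∑ k, f13 i k * p13 i k)) ≤ RTriple r s u p12 p23 p13 := by
  refine le_csSup ⟨1, ?_⟩ ⟨f12, f23, f13, h1, h2, h3, hf, rfl⟩
  rintro _ ⟨g12, g23, g13, g1, g2, g3, -, rfl⟩
  exact h.score_le_one g1 g2 g3

lemma ProbTriple.RTriple_le_one (h : ProbTriple r s u p12 p23 p13) :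
    RTriple r s u p12 p23 p13 ≤ 1 := by
  apply Real.sSup_le _ zero_le_one
  rintro _ ⟨g12, g23, g13, g1, g2, g3, -, rfl⟩
  exact h.score_le_one g1 g2 g3

end RTriple

section Risk

variable {r n12 n23 n13 : ℕ} {ψ : SampleSpace r n12 n23 n13 → ℝ}

lemma nullError_nonneg (hψ : ∀ ω, ψ ω ∈ Set.Icc (0 : ℝ) 1) : 0 ≤ nullError r n12 n23 n13 ψ := by
  apply Real.sSup_nonneg
  rintro _ ⟨p12, p23, p13, h, -, rfl⟩
  exact expTest_nonneg h fun ω => (hψ ω).1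

lemma altError_nonneg (hψ : ∀ ω, ψ ω ∈ Set.Icc (0 : ℝ) 1) (ρ : ℝ) :
    0 ≤ altError r n12 n23 n13 ρ ψ := by
  apply Real.sSup_nonneg
  rintro _ ⟨p12, p23, p13, h, -, rfl⟩
  exact expTest_nonneg h fun ω => sub_nonneg.mpr (hψ ω).2

lemma le_nullError (hψ : ∀ ω, ψ ω ∈ Set.Icc (0 : ℝ) 1) {p12 : Fin r → Fin 2 → ℝ}
    {p23 : Fin 2 → Fin 2 → ℝ} {p13 : Fin r → Fin 2 → ℝ} (h : ProbTriple r 2 2 p12 p23 p13)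
    (hc : CompatTriple r 2 2 p12 p23 p13) :
    expTest r n12 n23 n13 ψ p12 p23 p13 ≤ nullError r n12 n23 n13 ψ := by
  refine le_csSup ⟨1, ?_⟩ ⟨p12, p23, p13, h, hc, rfl⟩
  rintro _ ⟨p12, p23, p13, h, -, rfl⟩
  exact expTest_le_one h fun ω => (hψ ω).2

lemma le_altError (hψ : ∀ ω, ψ ω ∈ Set.Icc (0 : ℝ) 1) {ρ : ℝ} {p12 : Fin r → Fin 2 → ℝ}
    {p23 : Fin 2 → Fin 2 → ℝ} {p13 : Fin r → Fin 2 → ℝ} (h : ProbTriple r 2 2 p12 p23 p13)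
    (hc : ρ ≤ RTriple r 2 2 p12 p23 p13) :
    1 - expTest r n12 n23 n13 ψ p12 p23 p13 ≤ altError r n12 n23 n13 ρ ψ := by
  rw [← expTest_one_sub h]
  refine le_csSup ⟨1, ?_⟩ ⟨p12, p23, p13, h, hc, rfl⟩
  rintro _ ⟨p12, p23, p13, h, -, rfl⟩
  exact expTest_le_one h fun ω => sub_le_self _ (hψ ω).1

lemma altError_anti (hψ : ∀ ω, ψ ω ∈ Set.Icc (0 : ℝ) 1) {ρ ρ' : ℝ} (hρ : ρ' ≤ ρ) :
    altError r n12 n23 n13 ρ ψ ≤ altError r n12 n23 n13 ρ' ψ := by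
  refine Real.sSup_le ?_ (altError_nonneg hψ ρ')
  rintro _ ⟨p12, p23, p13, h, hR, rfl⟩
  rw [expTest_one_sub h]
  exact le_altError hψ h (hρ.trans hR)

lemma minimaxRisk_two_le : minimaxRisk r n12 n23 n13 2 ≤ 1 / 2 := by
  have h0 : nullError r n12 n23 n13 (fun _ => 0) ≤ 0 := by
    refine Real.sSup_le ?_ le_rfl
    rintro _ ⟨p12, p23, p13, h, -, rfl⟩
    simp [expTest]
  have h1 : altError r n12 n23 n13 2 (fun _ => 0) ≤ 0 := by
    refine Real.sSup_le ?_ le_rfl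
    rintro _ ⟨p12, p23, p13, h, hR, rfl⟩
    linarith [h.RTriple_le_one]
  have hψ : ∀ ω : SampleSpace r n12 n23 n13, (0 : ℝ) ∈ Set.Icc (0 : ℝ) 1 := fun _ => by simp
  rw [minimaxRisk_eq]
  refine le_trans (csInf_le (a := nullError r n12 n23 n13 (fun _ => 0) +
    altError r n12 n23 n13 2 (fun _ => 0)) ⟨0, ?_⟩ ⟨fun _ => 0, hψ, rfl⟩) (by linarith)
  rintro _ ⟨ψ, hψ, rfl⟩
  exact add_nonneg (nullError_nonneg hψ) (altError_nonneg hψ 2)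

lemma le_rhoStar {ρ : ℝ}
    (h : ∀ ψ : SampleSpace r n12 n23 n13 → ℝ, (∀ ω, ψ ω ∈ Set.Icc (0 : ℝ) 1) →
      3 / 5 ≤ nullError r n12 n23 n13 ψ + altError r n12 n23 n13 ρ ψ) :
    ρ ≤ rhoStar r n12 n23 n13 := by
  refine le_csInf ⟨2, by norm_num, minimaxRisk_two_le⟩ ?_
  rintro ρ' ⟨-, hρ'⟩
  by_contra! hlt
  have : 3 / 5 ≤ minimaxRisk r n12 n23 n13 ρ' := by
    rw [minimaxRisk_eq]
    refine le_csInf ⟨nullError r n12 n23 n13 (fun _ => 0) +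
      altError r n12 n23 n13 ρ' (fun _ => 0), fun _ => 0, fun _ => by simp, rfl⟩ ?_
    rintro _ ⟨ψ, hψ, rfl⟩
    linarith [h ψ hψ, altError_anti hψ hlt.le]
  linarith

/-- Le Cam's method with two finitely supported priors: each prior may charge families outside
its hypothesis, at a cost controlled by the expectation of `bad₀` or `bad₁`. -/
lemma le_rhoStar_of_priors {ι : Type*} [Fintype ι] {ρ : ℝ} {p12 : ι → Fin r → Fin 2 → ℝ}
    {p23 : ι → Fin 2 → Fin 2 → ℝ} {p13 : ι → Fin r → Fin 2 → ℝ} {w₀ w₁ bad₀ bad₁ : ι → ℝ}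
    (hP : ∀ a, ProbTriple r 2 2 (p12 a) (p23 a) (p13 a))
    (hw₀ : ∀ a, 0 ≤ w₀ a) (hw₁ : ∀ a, 0 ≤ w₁ a) (hs₀ : ∑ a, w₀ a = 1) (hs₁ : ∑ a, w₁ a = 1)
    (hb₀ : ∀ a, 0 ≤ bad₀ a) (hb₁ : ∀ a, 0 ≤ bad₁ a)
    (h₀ : ∀ a, CompatTriple r 2 2 (p12 a) (p23 a) (p13 a) ∨ 1 ≤ bad₀ a)
    (h₁ : ∀ a, ρ ≤ RTriple r 2 2 (p12 a) (p23 a) (p13 a) ∨ 1 ≤ bad₁ a)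
    (hm₀ : ∑ a, w₀ a * bad₀ a ≤ 1 / 10) (hm₁ : ∑ a, w₁ a * bad₁ a ≤ 1 / 10)
    (hdist : ∀ ψ : SampleSpace r n12 n23 n13 → ℝ, (∀ ω, ψ ω ∈ Set.Icc (0 : ℝ) 1) →
      ∑ a, (w₁ a - w₀ a) * expTest r n12 n23 n13 ψ (p12 a) (p23 a) (p13 a) ≤ 1 / 5) :
    ρ ≤ rhoStar r n12 n23 n13 := by
  refine le_rhoStar fun ψ hψ => ?_
  set E : ι → ℝ := fun a => expTest r n12 n23 n13 ψ (p12 a) (p23 a) (p13 a) with hE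
  have e0 : ∑ a, w₀ a * E a ≤ nullError r n12 n23 n13 ψ + 1 / 10 := by
    calc _ ≤ ∑ a, (w₀ a * nullError r n12 n23 n13 ψ + w₀ a * bad₀ a) := by
          refine Finset.sum_le_sum fun a _ => ?_
          rw [← mul_add]
          refine mul_le_mul_of_nonneg_left ?_ (hw₀ a)
          rcases h₀ a with h | h
          · exact (le_nullError hψ (hP a) h).trans (le_add_of_nonneg_right (hb₀ a))
          · exact (expTest_le_one (hP a) fun ω => (hψ ω).2).trans
              (h.trans (le_add_of_nonneg_left (nullError_nonneg hψ)))
      _ ≤ _ := by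
          rw [Finset.sum_add_distrib, ← Finset.sum_mul, hs₀, one_mul]
          gcongr
  have e1 : ∑ a, w₁ a * (1 - E a) ≤ altError r n12 n23 n13 ρ ψ + 1 / 10 := by
    calc _ ≤ ∑ a, (w₁ a * altError r n12 n23 n13 ρ ψ + w₁ a * bad₁ a) := by
          refine Finset.sum_le_sum fun a _ => ?_
          rw [← mul_add]
          refine mul_le_mul_of_nonneg_left ?_ (hw₁ a)
          rcases h₁ a with h | h
          · exact (le_altError hψ (hP a) h).trans (le_add_of_nonneg_right (hb₁ a))
          · have := expTest_nonneg (hP a) fun ω => (hψ ω).1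
            have := altError_nonneg hψ ρ
            linarith
      _ ≤ _ := by
          rw [Finset.sum_add_distrib, ← Finset.sum_mul, hs₁, one_mul]
          gcongr
  have e2 := hdist ψ hψ
  simp only [sub_mul, Finset.sum_sub_distrib] at e2
  simp only [mul_sub, mul_one, Finset.sum_sub_distrib, hs₁] at e1
  simp only [hE] at e0 e1
  linarith

lemma le_rhoStar_of_two_points {ρ : ℝ} {p12 q12 : Fin r → Fin 2 → ℝ} {p23 q23 : Fin 2 → Fin 2 → ℝ}
    {p13 q13 : Fin r → Fin 2 → ℝ} (hp : ProbTriple r 2 2 p12 p23 p13)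
    (hq : ProbTriple r 2 2 q12 q23 q13) (hc : CompatTriple r 2 2 p12 p23 p13)
    (hR : ρ ≤ RTriple r 2 2 q12 q23 q13)
    (hdist : ∀ ψ : SampleSpace r n12 n23 n13 → ℝ, (∀ ω, ψ ω ∈ Set.Icc (0 : ℝ) 1) →
      expTest r n12 n23 n13 ψ q12 q23 q13 - expTest r n12 n23 n13 ψ p12 p23 p13 ≤ 1 / 5) :
    ρ ≤ rhoStar r n12 n23 n13 := by
  refine le_rhoStar fun ψ hψ => ?_
  linarith [le_nullError hψ hp hc, le_altError hψ hq hR, hdist ψ hψ]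

end Risk

/-- The sign attached to a binary coordinate. -/
def binSign : Fin 2 → ℝ := ![1, -1]

@[simp] lemma binSign_zero : binSign 0 = 1 := rfl

@[simp] lemma binSign_one : binSign 1 = -1 := rfl

/-- The `{1, 2}` margin with first marginal `u` and conditional biases `e`. -/
noncomputable def biasedMargin {r : ℕ} (u e : Fin r → ℝ) (i : Fin r) (j : Fin 2) : ℝ :=
  u i * (1 + binSign j * e i) / 2

/-- The `{2, 3}` margin with correlation `τ`. -/
noncomputable def corrMargin (τ : ℝ) (j k : Fin 2) : ℝ :=
  (1 + binSign j * binSign k * τ) / 4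

/-- The `{1, 3}` margin under which the third coordinate is uniform and independent. -/
noncomputable def unifMargin {r : ℕ} (u : Fin r → ℝ) (i : Fin r) (_ : Fin 2) : ℝ :=
  u i / 2

section Margins

variable {r : ℕ} {u e : Fin r → ℝ} {τ : ℝ}

lemma biasedMargin_nonneg (hu : ∀ i, 0 ≤ u i) (he : ∀ i, |e i| ≤ 1) (i : Fin r) (j : Fin 2) :
    0 ≤ biasedMargin u e i j := by
  have h := abs_le.mp (he i)
  refine div_nonneg (mul_nonneg (hu i) ?_) zero_le_two
  fin_cases j <;> simp <;> linarith

lemma sum_biasedMargin (hs : ∑ i, u i = 1) : ∑ i, ∑ j, biasedMargin u e i j = 1 := by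
  rw [← hs]
  refine Finset.sum_congr rfl fun i _ => ?_
  simp [biasedMargin, Fin.sum_univ_two]
  ring

lemma corrMargin_nonneg (hτ : |τ| ≤ 1) (j k : Fin 2) : 0 ≤ corrMargin τ j k := by
  have h := abs_le.mp hτ
  refine div_nonneg ?_ (by norm_num)
  fin_cases j <;> fin_cases k <;> simp <;> linarith

lemma sum_corrMargin : ∑ j, ∑ k, corrMargin τ j k = 1 := by
  simp [corrMargin, Fin.sum_univ_two]
  ring

lemma unifMargin_nonneg (hu : ∀ i, 0 ≤ u i) (i : Fin r) (k : Fin 2) : 0 ≤ unifMargin u i k :=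
  div_nonneg (hu i) zero_le_two

lemma sum_unifMargin (hs : ∑ i, u i = 1) : ∑ i, ∑ k, unifMargin u i k = 1 := by
  rw [← hs]
  refine Finset.sum_congr rfl fun i _ => ?_
  simp [unifMargin]
  ring

lemma probTriple_margins (hu : ∀ i, 0 ≤ u i) (hs : ∑ i, u i = 1) (he : ∀ i, |e i| ≤ 1)
    (hτ : |τ| ≤ 1) : ProbTriple r 2 2 (biasedMargin u e) (corrMargin τ) (unifMargin u) :=
  ⟨biasedMargin_nonneg hu he, corrMargin_nonneg hτ, unifMargin_nonneg hu, sum_biasedMargin hs,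
    sum_corrMargin, sum_unifMargin hs⟩

lemma compatTriple_margins (hu : ∀ i, 0 ≤ u i) (hs : ∑ i, u i = 1) (he : ∀ i, |e i| ≤ 1)
    (hue : ∑ i, u i * e i = 0) (hτ0 : 0 ≤ τ) (hA : ∑ i, u i * |e i| < 1)
    (hτ : τ ≤ 1 - ∑ i, u i * |e i|) :
    CompatTriple r 2 2 (biasedMargin u e) (corrMargin τ) (unifMargin u) := by
  set A := ∑ i, u i * |e i| with hAdef
  set γ : Fin r → ℝ := fun i => τ / (1 - A) * (1 - |e i|) with hγ
  have hA1 : 0 < 1 - A := by linarith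
  have hγs : ∑ i, u i * γ i = τ := by
    have : ∀ i, u i * γ i = τ / (1 - A) * (u i - u i * |e i|) := by intro i; simp only [hγ]; ring
    simp only [this, ← Finset.mul_sum, Finset.sum_sub_distrib, hs, ← hAdef]
    field_simp
  have hγ0 : ∀ i, 0 ≤ γ i := fun i =>
    mul_nonneg (div_nonneg hτ0 hA1.le) (sub_nonneg.mpr (he i))
  have hγ1 : ∀ i, γ i ≤ 1 - |e i| := fun i =>
    mul_le_of_le_one_left (sub_nonneg.mpr (he i)) ((div_le_one hA1).mpr hτ)
  have hsum : ∀ j k : Fin 2, ∑ i, u i * (1 + binSign j * e i + binSign j * binSign k * γ i) / 4 =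
      corrMargin τ j k := by
    intro j k
    have : ∀ i, u i * (1 + binSign j * e i + binSign j * binSign k * γ i) / 4 =
      1 / 4 * u i + binSign j / 4 * (u i * e i) + binSign j * binSign k / 4 * (u i * γ i) := by
      intro i; ring
    simp only [this, Finset.sum_add_distrib, ← Finset.mul_sum, hs, hue, hγs, corrMargin]
    ring
  have h12 : ∀ i j, biasedMargin u e i j =
      ∑ k, u i * (1 + binSign j * e i + binSign j * binSign k * γ i) / 4 := by
    intro i j
    simp [Fin.sum_univ_two, biasedMargin]
    ring
  refine ⟨fun i j k => u i * (1 + binSign j * e i + binSign j * binSign k * γ i) / 4,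
    fun i j k => ?_, ?_, h12, fun j k => (hsum j k).symm, fun i k => ?_⟩
  · refine div_nonneg (mul_nonneg (hu i) ?_) (by norm_num)
    have h1 := neg_abs_le (e i)
    have h2 := le_abs_self (e i)
    have h3 := hγ0 i
    have h4 := hγ1 i
    fin_cases j <;> fin_cases k <;> simp <;> linarith
  · simp only [← h12]
    exact sum_biasedMargin hs
  · simp [Fin.sum_univ_two, unifMargin]
    ring

lemma le_RTriple_margins (hu : ∀ i, 0 ≤ u i) (hs : ∑ i, u i = 1) (he : ∀ i, |e i| ≤ 1)
    (hτ : |τ| ≤ 1) : (τ - (1 - ∑ i, u i * |e i|)) / 3 ≤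
      RTriple r 2 2 (biasedMargin u e) (corrMargin τ) (unifMargin u) := by
  obtain ⟨g, hg, hge⟩ : ∃ g : Fin r → ℝ, (∀ i, g i = 1 ∨ g i = -1) ∧ ∀ i, g i * e i = |e i| := by
    refine ⟨fun i => if 0 ≤ e i then 1 else -1, fun i => ?_, fun i => ?_⟩
    · by_cases h : 0 ≤ e i <;> simp [h]
    · by_cases h : 0 ≤ e i
      · simp [h, abs_of_nonneg h]
      · simp [h, abs_of_neg (not_le.mp h)]
  have key := (probTriple_margins hu hs he hτ).score_le_RTriple
    (f12 := fun i j => -(g i * binSign j)) (f23 := fun j k => -(binSign j * binSign k))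
    (f13 := fun i k => 1 + g i * binSign k)
    (fun i j => by rcases hg i with h | h <;> fin_cases j <;> simp [h])
    (fun j k => by fin_cases j <;> fin_cases k <;> simp)
    (fun i k => by rcases hg i with h | h <;> fin_cases k <;> simp [h] <;> norm_num)
    (fun i j k => by
      rcases hg i with h | h <;> fin_cases j <;> fin_cases k <;> simp [h])
  refine le_trans (le_of_eq ?_) key
  have s1 : ∑ i, ∑ j, -(g i * binSign j) * biasedMargin u e i j = -∑ i, u i * |e i| := by
    rw [← Finset.sum_neg_distrib]
    refine Finset.sum_congr rfl fun i _ => ?_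
    simp [Fin.sum_univ_two, biasedMargin, ← hge]
    ring
  have s2 : ∑ j, ∑ k, -(binSign j * binSign k) * corrMargin τ j k = -τ := by
    simp [Fin.sum_univ_two, corrMargin]
    ring
  have s3 : ∑ i, ∑ k, (1 + g i * binSign k) * unifMargin u i k = 1 := by
    refine Eq.trans (Finset.sum_congr rfl fun i _ => ?_) hs
    simp [Fin.sum_univ_two, unifMargin]
    ring
  rw [s1, s2, s3]
  ring

end Margins

/-- A partition of all but at most one of the points of `Fin r` into `r / 2` pairs, with
weights `u`, signs `σ` and block labels `b`. -/
structure Pairing (r : ℕ) where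
  u : Fin r → ℝ
  σ : Fin r → ℝ
  b : Fin r → Fin (r / 2)
  u_nonneg : ∀ i, 0 ≤ u i
  σ_eq : ∀ i, σ i = 1 ∨ σ i = -1
  sum_eq : ∀ F : Fin (r / 2) → ℝ → ℝ,
    ∑ i, u i * F (b i) (σ i) = 1 / (2 * (r / 2 : ℕ)) * ∑ b, (F b 1 + F b (-1))

lemma sum_range_two_mul (g : ℕ → ℝ) (m : ℕ) :
    ∑ i ∈ Finset.range (2 * m), g i = ∑ b ∈ Finset.range m, (g (2 * b) + g (2 * b + 1)) := by
  induction m with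
  | zero => simp
  | succ m ih =>
    rw [show 2 * (m + 1) = 2 * m + 1 + 1 by ring, Finset.sum_range_succ, Finset.sum_range_succ,
      ih, Finset.sum_range_succ, add_assoc]

lemma Pairing.nonempty {r : ℕ} (hr : 2 ≤ r) : Nonempty (Pairing r) := by
  have hm : 0 < r / 2 := by omega
  let b : ℕ → Fin (r / 2) := fun i => if h : i / 2 < r / 2 then ⟨i / 2, h⟩ else ⟨0, hm⟩
  let σ : ℕ → ℝ := fun i => if i % 2 = 0 then 1 else -1
  let u : ℕ → ℝ := fun i => if i < 2 * (r / 2) then 1 / (2 * (r / 2 : ℕ)) else 0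
  refine ⟨⟨fun i => u i, fun i => σ i, fun i => b i, fun i => ?_, fun i => ?_, fun F => ?_⟩⟩
  · simp only [u]
    split_ifs <;> positivity
  · simp only [σ]
    split_ifs <;> simp
  · rw [Fin.sum_univ_eq_sum_range (fun i => u i * F (b i) (σ i)) r,
      ← Finset.sum_subset (s₁ := Finset.range (2 * (r / 2)))
        (by intro i hi; simp only [Finset.mem_range] at hi ⊢; omega)
        (by intro i _ hi; simp only [Finset.mem_range] at hi; simp [u, hi]),
      sum_range_two_mul,
      ← Fin.sum_univ_eq_sum_range (fun k => u (2 * k) * F (b (2 * k)) (σ (2 * k)) +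
        u (2 * k + 1) * F (b (2 * k + 1)) (σ (2 * k + 1))) (r / 2), Finset.mul_sum]
    refine Finset.sum_congr rfl fun k _ => ?_
    have hk := k.2
    have b1 : b (2 * k) = k := by
      simp only [b]
      rw [dif_pos (by omega)]
      ext
      simp only
      omega
    have b2 : b (2 * k + 1) = k := by
      simp only [b]
      rw [dif_pos (by omega)]
      ext
      simp only
      omega
    have s1 : σ (2 * k) = 1 := by simp [σ]
    have s2 : σ (2 * k + 1) = -1 := if_neg (by omega)
    have u1 : u (2 * k) = 1 / (2 * (r / 2 : ℕ)) := if_pos (by omega)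
    have u2 : u (2 * k + 1) = 1 / (2 * (r / 2 : ℕ)) := if_pos (by omega)
    rw [b1, b2, s1, s2, u1, u2]
    ring

namespace Pairing

variable {r : ℕ} (D : Pairing r)

lemma σ_sq (i : Fin r) : D.σ i ^ 2 = 1 := by
  rcases D.σ_eq i with h | h <;> simp [h]

lemma abs_σ (i : Fin r) : |D.σ i| = 1 := by
  rcases D.σ_eq i with h | h <;> simp [h]

lemma sum_u (hr : 2 ≤ r) : ∑ i, D.u i = 1 := by
  have h := D.sum_eq fun _ _ => 1
  have hm : ((r / 2 : ℕ) : ℝ) ≠ 0 := by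
    have : r / 2 ≠ 0 := by omega
    exact_mod_cast this
  simp only [mul_one, Finset.sum_const, Finset.card_univ, Fintype.card_fin, nsmul_eq_mul] at h
  rw [h]
  field_simp
  norm_num

/-- The biases `± ε` attached to the two points of each pair. -/
def bias (ε : Fin (r / 2) → ℝ) (i : Fin r) : ℝ := D.σ i * ε (D.b i)

lemma sum_u_mul_bias (ε : Fin (r / 2) → ℝ) : ∑ i, D.u i * D.bias ε i = 0 := by
  have h := D.sum_eq fun b s => s * ε b
  simpa [bias] using h

lemma abs_bias (ε : Fin (r / 2) → ℝ) (i : Fin r) : |D.bias ε i| = |ε (D.b i)| := by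
  rw [bias, abs_mul, abs_σ, one_mul]

lemma sum_u_mul_abs_bias (ε : Fin (r / 2) → ℝ) :
    ∑ i, D.u i * |D.bias ε i| = 1 / (r / 2 : ℕ) * ∑ b, |ε b| := by
  have h := D.sum_eq fun b _ => |ε b|
  simp only [abs_bias]
  rw [h, Finset.sum_add_distrib]
  ring

lemma sum_u_mul_ite (b : Fin (r / 2)) :
    ∑ i, D.u i * (if D.b i = b then 1 else 0) = 1 / (r / 2 : ℕ) := by
  have h := D.sum_eq fun b' _ => if b' = b then 1 else 0
  rw [h, Finset.sum_add_distrib]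
  simp
  ring

end Pairing

/-- Indistinguishability of a product law from a multiplicative perturbation of relative size
of order `1 / √n`. -/
lemma abs_sum_two_point_le {α : Type*} [Fintype α] {q q' ζ : α → ℝ} {n : ℕ} (hn : 0 < n)
    (hq : ∀ x, 0 ≤ q x) (hq1 : ∑ x, q x = 1) (hζ : ∑ x, q x * ζ x = 0)
    (hκ : ∑ x, q x * ζ x ^ 2 ≤ 4 / 3) (hq' : ∀ x, q' x = q x * (1 + ζ x * (1 / (30 * √n))))
    {φ : (Fin n → α) → ℝ} (hφ : ∀ ω, |φ ω| ≤ 1) :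
    ∑ ω, φ ω * ∏ l, q' (ω l) - ∑ ω, φ ω * ∏ l, q (ω l) ≤ 1 / 5 := by
  have hn' : (0 : ℝ) < n := by exact_mod_cast hn
  have h0 : (0 : ℝ) ≤ 1 / (30 * √n) := by positivity
  have h := abs_sum_mixture_le (v := fun c : Bool => if c then (1 : ℝ) else -1)
    (y := fun c : Bool => if c then 1 / (30 * √n) else 0) (K := 1) (R := 400) hq hq1 hζ hκ h0
    (fun c => by cases c <;> simp only [if_true, Bool.false_eq_true, if_false, abs_zero, h0,
      abs_of_nonneg h0, le_refl]) (by simp; norm_num)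
    (fun k hk => by
      obtain rfl : k = 0 := by omega
      simp) (by norm_num) hφ
  simp only [Fintype.sum_bool, if_true, Bool.false_eq_true, if_false, mul_zero, add_zero, mul_one,
    ← hq', one_mul, neg_mul, mul_add (φ _), mul_neg, Finset.sum_add_distrib, Finset.sum_neg_distrib] at h
  have hsq : 1 + 400 * (4 / 3) * (1 / (30 * √n)) ^ 2 ≤ 1 + 1 / (n : ℝ) := by
    rw [div_pow, mul_pow, Real.sq_sqrt hn'.le]
    field_simp
    linarith
  have hpow : (1 + 400 * (4 / 3) * (1 / (30 * √n)) ^ 2) ^ n ≤ 3 := by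
    calc _ ≤ (1 + 1 / (n : ℝ)) ^ n := by gcongr
      _ ≤ Real.exp (1 / (n : ℝ)) ^ n := by
          gcongr
          rw [add_comm]
          exact Real.add_one_le_exp _
      _ = Real.exp 1 := by
          rw [← Real.exp_nat_mul]
          congr 1
          field_simp
      _ ≤ 3 := by linarith [Real.exp_one_lt_d9]
  have hs : √(4 / 400 ^ 1 * (1 + 400 * (4 / 3) * (1 / (30 * √n)) ^ 2) ^ n) ≤ 1 / 5 := by
    rw [Real.sqrt_le_left (by norm_num)]
    nlinarith
  linarith [le_abs_self (∑ ω, φ ω * ∏ l, q' (ω l) + -∑ ω, φ ω * ∏ l, q (ω l))]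

lemma le_rhoStar_fst {r n12 : ℕ} (n23 n13 : ℕ) (hr : 2 ≤ r) (hn : 0 < n12) :
    1 / 90 * (1 / √n12) ≤ rhoStar r n12 n23 n13 := by
  obtain ⟨D⟩ := Pairing.nonempty hr
  have hm : ((r / 2 : ℕ) : ℝ) ≠ 0 := by
    have : r / 2 ≠ 0 := by omega
    exact_mod_cast this
  have hs1 : 1 ≤ √(n12 : ℝ) := Real.one_le_sqrt.mpr (by exact_mod_cast hn)
  set h : ℝ := 1 / (30 * √n12) with hh
  have h0 : 0 ≤ h := by positivity
  have h1 : h ≤ 1 / 30 := by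
    rw [hh]
    gcongr
    linarith
  have hA : ∀ t : ℝ, 0 ≤ t → ∑ i, D.u i * |D.bias (fun _ => t) i| = t := fun t ht => by
    rw [D.sum_u_mul_abs_bias]
    simp [abs_of_nonneg ht, hm]
  have hb : ∀ t : ℝ, 0 ≤ t → t ≤ 1 → ∀ i, |D.bias (fun _ => t) i| ≤ 1 := fun t ht ht1 i => by
    rwa [D.abs_bias, abs_of_nonneg ht]
  have hτ : |(1 / 2 : ℝ)| ≤ 1 := by norm_num [abs_le]
  have hb0 := hb (1 / 2) (by norm_num) (by norm_num)
  have hb1 := hb (1 / 2 + h) (by linarith) (by linarith)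
  refine le_rhoStar_of_two_points (probTriple_margins D.u_nonneg (D.sum_u hr) hb0 hτ)
    (probTriple_margins D.u_nonneg (D.sum_u hr) hb1 hτ)
    (compatTriple_margins D.u_nonneg (D.sum_u hr) hb0 (D.sum_u_mul_bias _) (by norm_num)
      (by rw [hA _ (by norm_num)]; norm_num) (by rw [hA _ (by norm_num)]; norm_num))
    (le_trans (le_of_eq ?_) (le_RTriple_margins D.u_nonneg (D.sum_u hr) hb1 hτ)) fun ψ hψ => ?_
  · rw [hA _ (by linarith), hh]
    field_simp
    ring
  · obtain ⟨φ, hφ, hE⟩ := exists_expTest_eq_sum_fst (n12 := n12) (n23 := n23) (n13 := n13)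
      (corrMargin_nonneg hτ) (unifMargin_nonneg D.u_nonneg) sum_corrMargin
      (sum_unifMargin (D.sum_u hr)) hψ
    rw [hE, hE]
    set q : Fin r × Fin 2 → ℝ := fun x => biasedMargin D.u (D.bias fun _ => 1 / 2) x.1 x.2 with hq
    set q' : Fin r × Fin 2 → ℝ :=
      fun x => biasedMargin D.u (D.bias fun _ => 1 / 2 + h) x.1 x.2 with hq'
    set ζ : Fin r × Fin 2 → ℝ :=
      fun x => binSign x.2 * D.σ x.1 / (1 + binSign x.2 * D.σ x.1 / 2) with hζ
    have a1 : ∑ x, q x = 1 := by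
      rw [Fintype.sum_prod_type]
      exact sum_biasedMargin (D.sum_u hr)
    have a2 : ∑ x, q x * ζ x = 0 := by
      rw [Fintype.sum_prod_type]
      refine Finset.sum_eq_zero fun i _ => ?_
      rcases D.σ_eq i with h | h <;>
        simp only [hq, hζ, Fin.sum_univ_two, biasedMargin, Pairing.bias, h, binSign_zero,
          binSign_one] <;> ring
    have a3 : ∑ x, q x * ζ x ^ 2 = 4 / 3 := by
      rw [Fintype.sum_prod_type]
      refine (Finset.sum_congr rfl fun i _ => ?_).trans
        (b := ∑ i, D.u i * (4 / 3)) (by rw [← Finset.sum_mul, D.sum_u hr, one_mul])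
      rcases D.σ_eq i with h | h <;>
        simp only [hq, hζ, Fin.sum_univ_two, biasedMargin, Pairing.bias, h, binSign_zero,
          binSign_one] <;> ring
    have a4 : ∀ x, q' x = q x * (1 + ζ x * h) := by
      rintro ⟨i, j⟩
      rcases D.σ_eq i with h | h <;> fin_cases j <;>
        simp only [hq, hq', hζ, biasedMargin, Pairing.bias, h, Fin.zero_eta, Fin.mk_one,
          binSign_zero, binSign_one] <;> ring
    exact abs_sum_two_point_le hn (fun x => biasedMargin_nonneg D.u_nonneg hb0 _ _) a1 a2 a3.le
      a4 hφ

lemma le_rhoStar_snd {r n23 : ℕ} (n12 n13 : ℕ) (hr : 2 ≤ r) (hn : 0 < n23) :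
    1 / 90 * (1 / √n23) ≤ rhoStar r n12 n23 n13 := by
  obtain ⟨D⟩ := Pairing.nonempty hr
  have hm : ((r / 2 : ℕ) : ℝ) ≠ 0 := by
    have : r / 2 ≠ 0 := by omega
    exact_mod_cast this
  have hs1 : 1 ≤ √(n23 : ℝ) := Real.one_le_sqrt.mpr (by exact_mod_cast hn)
  set h : ℝ := 1 / (30 * √n23) with hh
  have h0 : 0 ≤ h := by positivity
  have h1 : h ≤ 1 / 30 := by
    rw [hh]
    gcongr
    linarith
  have hA : ∑ i, D.u i * |D.bias (fun _ => 1 / 2) i| = 1 / 2 := by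
    rw [D.sum_u_mul_abs_bias]
    simp [hm]
  have hb0 : ∀ i, |D.bias (fun _ => 1 / 2) i| ≤ 1 := fun i => by
    rw [D.abs_bias]
    norm_num [abs_le]
  have hτ0 : |(1 / 2 : ℝ)| ≤ 1 := by norm_num [abs_le]
  have hτ1 : |1 / 2 + h| ≤ 1 := abs_le.mpr ⟨by linarith, by linarith⟩
  refine le_rhoStar_of_two_points (probTriple_margins D.u_nonneg (D.sum_u hr) hb0 hτ0)
    (probTriple_margins D.u_nonneg (D.sum_u hr) hb0 hτ1)
    (compatTriple_margins D.u_nonneg (D.sum_u hr) hb0 (D.sum_u_mul_bias _) (by norm_num)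
      (by rw [hA]; norm_num) (by rw [hA]; norm_num))
    (le_trans (le_of_eq ?_) (le_RTriple_margins D.u_nonneg (D.sum_u hr) hb0 hτ1)) fun ψ hψ => ?_
  · rw [hA, hh]
    field_simp
    norm_num
  · obtain ⟨φ, hφ, hE⟩ := exists_expTest_eq_sum_snd (n12 := n12) (n23 := n23) (n13 := n13)
      (biasedMargin_nonneg D.u_nonneg hb0) (unifMargin_nonneg D.u_nonneg)
      (sum_biasedMargin (D.sum_u hr)) (sum_unifMargin (D.sum_u hr)) hψ
    rw [hE, hE]
    set q : Fin 2 × Fin 2 → ℝ := fun x => corrMargin (1 / 2) x.1 x.2 with hq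
    set q' : Fin 2 × Fin 2 → ℝ := fun x => corrMargin (1 / 2 + h) x.1 x.2 with hq'
    set ζ : Fin 2 × Fin 2 → ℝ :=
      fun x => binSign x.1 * binSign x.2 / (1 + binSign x.1 * binSign x.2 / 2) with hζ
    have a1 : ∑ x, q x = 1 := by
      rw [Fintype.sum_prod_type]
      exact sum_corrMargin
    have a2 : ∑ x, q x * ζ x = 0 := by
      norm_num [hq, hζ, Fintype.sum_prod_type, Fin.sum_univ_two, corrMargin]
    have a3 : ∑ x, q x * ζ x ^ 2 = 4 / 3 := by
      norm_num [hq, hζ, Fintype.sum_prod_type, Fin.sum_univ_two, corrMargin]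
    have a4 : ∀ x, q' x = q x * (1 + ζ x * h) := by
      rintro ⟨j, k⟩
      fin_cases j <;> fin_cases k <;>
        simp only [hq, hq', hζ, corrMargin, Fin.zero_eta, Fin.mk_one, binSign_zero, binSign_one] <;>
        ring
    exact abs_sum_two_point_le hn (fun x => corrMargin_nonneg hτ0 _ _) a1 a2 a3.le a4 hφ

namespace Pairing

variable {r : ℕ} (D : Pairing r) {ι : Type*} [Fintype ι] {w₀ w₁ x : ι → ℝ} {δ : ℝ}

/-- Changing the sign distribution of a single block is invisible when the two distributions share
many moments. -/
lemma abs_sum_update_block_le (hr : 2 ≤ r) (hδ0 : 0 ≤ δ) (hδ1 : δ ≤ 1) (hx : ∀ c, |x c| ≤ 1)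
    (h0 : ∀ c, 0 ≤ w₀ c) (h1 : ∀ c, 0 ≤ w₁ c) (hs0 : ∑ c, w₀ c = 1) (hs1 : ∑ c, w₁ c = 1)
    {K : ℕ} (hK : ∀ k < K, ∑ c, w₀ c * x c ^ k = ∑ c, w₁ c * x c ^ k) {R : ℝ} (hR : 1 ≤ R)
    {n : ℕ} {φ : (Fin n → Fin r × Fin 2) → ℝ} (hφ : ∀ ω, |φ ω| ≤ 1)
    (a : Fin (r / 2) → ι) (b' : Fin (r / 2)) :
    |∑ c, (w₁ c - w₀ c) * ∑ ω, φ ω * ∏ l, biasedMargin D.u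
        (D.bias fun b => δ * x (Function.update a b' c b)) (ω l).1 (ω l).2| ≤
      √(4 / R ^ K * (1 + R * (1 / (r / 2 : ℕ)) * δ ^ 2) ^ n) := by
  have hε : ∀ c, |δ * x c| ≤ δ := fun c => by
    rw [abs_mul, abs_of_nonneg hδ0]
    exact mul_le_of_le_one_right hδ0 (hx c)
  set e : Fin r → ℝ := fun i => if D.b i = b' then 0 else D.bias (fun b => δ * x (a b)) i with he
  have he1 : ∀ i, |e i| ≤ 1 := fun i => by
    simp only [he]
    split_ifs
    · simp
    · rw [D.abs_bias]
      exact (hε _).trans hδ1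
  set q : Fin r × Fin 2 → ℝ := fun z => biasedMargin D.u e z.1 z.2 with hq
  set ζ : Fin r × Fin 2 → ℝ :=
    fun z => if D.b z.1 = b' then binSign z.2 * D.σ z.1 else 0 with hζ
  have a1 : ∑ z, q z = 1 := by
    rw [Fintype.sum_prod_type]
    exact sum_biasedMargin (D.sum_u hr)
  have a2 : ∑ z, q z * ζ z = 0 := by
    rw [Fintype.sum_prod_type]
    refine Finset.sum_eq_zero fun i _ => ?_
    by_cases h : D.b i = b'
    · simp only [hq, hζ, he, h, Fin.sum_univ_two, biasedMargin, if_true, binSign_zero, binSign_one]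
      ring
    · simp [hζ, h]
  have a3 : ∑ z, q z * ζ z ^ 2 = 1 / (r / 2 : ℕ) := by
    rw [Fintype.sum_prod_type, ← D.sum_u_mul_ite b']
    refine Finset.sum_congr rfl fun i _ => ?_
    by_cases h : D.b i = b'
    · simp only [hq, hζ, he, h, Fin.sum_univ_two, biasedMargin, if_true, binSign_zero, binSign_one,
        mul_pow, D.σ_sq]
      ring
    · simp [hζ, h]
  have a4 : ∀ c z, biasedMargin D.u (D.bias fun b => δ * x (Function.update a b' c b)) z.1 z.2 =
      q z * (1 + ζ z * (δ * x c)) := by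
    rintro c ⟨i, j⟩
    by_cases h : D.b i = b'
    · simp only [hq, hζ, he, h, biasedMargin, bias, if_true, Function.update_self]
      ring
    · simp only [hq, hζ, he, h, biasedMargin, bias, if_false, Function.update_of_ne h]
      ring
  have hv : ∑ c, |w₁ c - w₀ c| ≤ 2 := by
    calc _ ≤ ∑ c, (w₁ c + w₀ c) := Finset.sum_le_sum fun c _ =>
          abs_le.mpr ⟨by linarith [h0 c, h1 c], by linarith [h0 c, h1 c]⟩
      _ = 2 := by
          rw [Finset.sum_add_distrib, hs0, hs1]
          norm_num
  have hmom : ∀ k < K, ∑ c, (w₁ c - w₀ c) * (δ * x c) ^ k = 0 := fun k hk => by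
    have : ∀ c, (w₁ c - w₀ c) * (δ * x c) ^ k = δ ^ k * (w₁ c * x c ^ k - w₀ c * x c ^ k) := by
      intro c
      ring
    simp only [this, ← Finset.mul_sum, Finset.sum_sub_distrib, hK k hk, sub_self, mul_zero]
  have key := abs_sum_mixture_le (n := n) (fun z => biasedMargin_nonneg D.u_nonneg he1 z.1 z.2) a1
    a2 a3.le hδ0 hε hv hmom hR hφ
  convert key using 2
  simp only [a4, Finset.mul_sum]
  rw [Finset.sum_comm]
  refine Finset.sum_congr rfl fun ω _ => Finset.sum_congr rfl fun c _ => ?_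
  ring

end Pairing

lemma sqrt_mixture_bound_le {n m M : ℕ} {δ : ℝ} (hm : 0 < m)
    (h : n * δ ^ 2 * Real.exp 3 ≤ 2 * M * m) :
    √(4 / Real.exp 3 ^ (2 * M) * (1 + Real.exp 3 * (1 / m) * δ ^ 2) ^ n) ≤
      2 * Real.exp (-(2 * M)) := by
  have hm' : (0 : ℝ) < m := by exact_mod_cast hm
  rw [Real.sqrt_le_left (by positivity)]
  have h1 : (1 + Real.exp 3 * (1 / m) * δ ^ 2) ^ n ≤ Real.exp (2 * M) := by
    calc _ ≤ Real.exp (Real.exp 3 * (1 / m) * δ ^ 2) ^ n := by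
          gcongr
          rw [add_comm]
          exact Real.add_one_le_exp _
      _ = Real.exp (n * (Real.exp 3 * (1 / m) * δ ^ 2)) := (Real.exp_nat_mul _ _).symm
      _ ≤ _ := by
          refine Real.exp_le_exp.mpr ?_
          rw [show n * (Real.exp 3 * (1 / m) * δ ^ 2) = n * δ ^ 2 * Real.exp 3 / m by ring,
            div_le_iff₀ hm']
          exact h
  calc _ ≤ 4 / Real.exp 3 ^ (2 * M) * Real.exp (2 * M) := by gcongr
    _ = _ := by
        rw [← Real.exp_nat_mul, mul_pow, ← Real.exp_nat_mul, div_mul_eq_mul_div, mul_div_assoc,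
          ← Real.exp_sub]
        push_cast
        congr 2
        · norm_num
        · ring

lemma ten_le_exp_three : 10 ≤ Real.exp 3 := by
  have h := Real.exp_one_gt_d9
  have : Real.exp 3 = Real.exp 1 ^ 3 := by
    rw [← Real.exp_nat_mul]
    norm_num
  rw [this]
  calc (10 : ℝ) ≤ 2.5 ^ 3 := by norm_num
    _ ≤ _ := by
        gcongr
        linarith

lemma le_rhoStar_of_blocks {r n12 M : ℕ} (n23 n13 : ℕ) (hr : 2 ≤ r) (hM : 0 < M) {δ : ℝ}
    (hδ0 : 0 ≤ δ) (hδ1 : δ ≤ 1 / 2)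
    (hn : n12 * δ ^ 2 * Real.exp 3 ≤ 2 * M * (r / 2 : ℕ))
    (hexp : 2 * (r / 2 : ℕ) * Real.exp (-(2 * M)) ≤ 1 / 5)
    (hm : 480000 * (M : ℝ) ^ 2 ≤ (r / 2 : ℕ)) :
    δ / (600 * M) ≤ rhoStar r n12 n23 n13 := by
  obtain ⟨D⟩ := Pairing.nonempty hr
  obtain ⟨x, w₀, w₁, hx, h0, h1, hs0, hs1, hmom, hgap⟩ := exists_moment_matching hM
  have hM' : (0 : ℝ) < M := by exact_mod_cast hM
  have hmpos : 0 < r / 2 := by omega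
  have hm' : (0 : ℝ) < (r / 2 : ℕ) := by exact_mod_cast hmpos
  set μ₀ := ∑ a, w₀ a * |x a| with hμ₀
  set μ₁ := ∑ a, w₁ a * |x a| with hμ₁
  have hμ₀0 : 0 ≤ μ₀ := Finset.sum_nonneg fun a _ => mul_nonneg (h0 a) (abs_nonneg _)
  have hμ₁1 : μ₁ ≤ 1 := by
    rw [← hs1]
    exact Finset.sum_le_sum fun a _ => mul_le_of_le_one_right (h1 a) (hx a)
  set s := (μ₁ - μ₀) / 4 with hs
  have hsM : 1 / (200 * (M : ℝ)) ≤ s := by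
    rw [hs, le_div_iff₀ (by norm_num)]
    refine le_trans (le_of_eq ?_) hgap
    field_simp
    norm_num
  have hs0' : 0 < s := lt_of_lt_of_le (by positivity) hsM
  set T := δ * (μ₀ + μ₁) / 2 with hT
  have hT0 : 0 ≤ T := by
    have : 0 ≤ δ * (μ₀ + μ₁) := mul_nonneg hδ0 (by linarith)
    linarith
  have hT1 : T ≤ 1 / 2 := by
    have : δ * (μ₀ + μ₁) ≤ 1 / 2 * 2 := mul_le_mul hδ1 (by linarith) (by linarith) (by norm_num)
    linarith
  have hτ : |1 - T| ≤ 1 := abs_le.mpr ⟨by linarith, by linarith⟩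
  have hb : ∀ a : Fin (r / 2) → Bool × Fin (4 * M), ∀ i,
      |D.bias (fun b => δ * x (a b)) i| ≤ 1 := fun a i => by
    rw [D.abs_bias, abs_mul, abs_of_nonneg hδ0]
    exact mul_le_one₀ (by linarith) (abs_nonneg _) (hx _)
  have hA : ∀ a : Fin (r / 2) → Bool × Fin (4 * M),
      ∑ i, D.u i * |D.bias (fun b => δ * x (a b)) i| = δ * ((∑ b, |x (a b)|) / (r / 2 : ℕ)) := by
    intro a
    rw [D.sum_u_mul_abs_bias]
    simp only [abs_mul, abs_of_nonneg hδ0, ← Finset.mul_sum]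
    ring
  have hlarge : Real.exp (-((r / 2 : ℕ) * s ^ 2 / 4)) ≤ 1 / 10 := by
    have h2 : 3 ≤ (r / 2 : ℕ) * s ^ 2 / 4 := by
      calc (3 : ℝ) = 480000 * (M : ℝ) ^ 2 * (1 / (200 * (M : ℝ))) ^ 2 / 4 := by
            field_simp
            norm_num
        _ ≤ _ := by gcongr
    calc _ ≤ Real.exp (-3) := Real.exp_le_exp.mpr (by linarith)
      _ = (Real.exp 3)⁻¹ := Real.exp_neg _
      _ ≤ _ := by
          rw [inv_eq_one_div]
          exact one_div_le_one_div_of_le (by norm_num) ten_le_exp_three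
  refine le_rhoStar_of_priors
    (p12 := fun a => biasedMargin D.u (D.bias fun b => δ * x (a b)))
    (p23 := fun _ => corrMargin (1 - T)) (p13 := fun _ => unifMargin D.u)
    (w₀ := fun a => ∏ b, w₀ (a b)) (w₁ := fun a => ∏ b, w₁ (a b))
    (bad₀ := fun a => Real.exp (s / 2 * ∑ b, ((|x (a b)| - μ₀) - s)))
    (bad₁ := fun a => Real.exp (s / 2 * ∑ b, ((μ₁ - |x (a b)|) - s)))
    (fun a => probTriple_margins D.u_nonneg (D.sum_u hr) (hb a) hτ)
    (fun a => Finset.prod_nonneg fun b _ => h0 _) (fun a => Finset.prod_nonneg fun b _ => h1 _)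
    (sum_prod_eq_one hs0 _) (sum_prod_eq_one hs1 _) (fun a => (Real.exp_pos _).le)
    (fun a => (Real.exp_pos _).le) (fun a => ?_) (fun a => ?_) ?_ ?_ fun ψ hψ => ?_
  · rcases le_total (∑ b, ((|x (a b)| - μ₀) - s)) 0 with h | h
    · left
      simp only [Finset.sum_sub_distrib, Finset.sum_const, Finset.card_univ, Fintype.card_fin,
        nsmul_eq_mul] at h
      have hAT : δ * ((∑ b, |x (a b)|) / (r / 2 : ℕ)) ≤ T := by
        have : (∑ b, |x (a b)|) / (r / 2 : ℕ) ≤ μ₀ + s := by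
          rw [div_le_iff₀ hm']
          linarith
        have h5 : μ₀ + s ≤ (μ₀ + μ₁) / 2 := by linarith
        calc _ ≤ δ * ((μ₀ + μ₁) / 2) := mul_le_mul_of_nonneg_left (this.trans h5) hδ0
          _ = T := by
              rw [hT]
              ring
      exact compatTriple_margins D.u_nonneg (D.sum_u hr) (hb a) (D.sum_u_mul_bias _)
        (by linarith) (by rw [hA]; linarith) (by rw [hA]; linarith)
    · exact Or.inr (Real.one_le_exp (mul_nonneg (by linarith) h))
  · rcases le_total (∑ b, ((μ₁ - |x (a b)|) - s)) 0 with h | h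
    · left
      simp only [Finset.sum_sub_distrib, Finset.sum_const, Finset.card_univ, Fintype.card_fin,
        nsmul_eq_mul] at h
      refine le_trans ?_ (le_RTriple_margins D.u_nonneg (D.sum_u hr) (hb a) hτ)
      rw [hA]
      have h4 : μ₁ - s ≤ (∑ b, |x (a b)|) / (r / 2 : ℕ) := by
        rw [le_div_iff₀ hm']
        linarith
      have h5 := mul_le_mul_of_nonneg_left h4 hδ0
      have h6 := mul_le_mul_of_nonneg_left hsM hδ0
      have h7 : δ * (μ₁ - s) - T = δ * s := by
        rw [hT, hs]
        ring
      have h8 : δ / (600 * M) = δ * (1 / (200 * M)) / 3 := by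
        field_simp
        ring
      rw [h8]
      linarith
    · exact Or.inr (Real.one_le_exp (mul_nonneg (by linarith) h))
  · refine (sum_prod_mul_exp_le (f := fun c => |x c| - μ₀) h0 hs0 (fun c => ?_) ?_ hs0'.le
      (by linarith) _).trans hlarge
    · exact abs_le.mpr ⟨by linarith [abs_nonneg (x c)], by linarith [hx c]⟩
    · simp only [mul_sub, Finset.sum_sub_distrib, ← Finset.sum_mul, hs0, one_mul, ← hμ₀, sub_self]
  · refine (sum_prod_mul_exp_le (f := fun c => μ₁ - |x c|) h1 hs1 (fun c => ?_) ?_ hs0'.le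
      (by linarith) _).trans hlarge
    · exact abs_le.mpr ⟨by linarith [hx c], by linarith [abs_nonneg (x c)]⟩
    · simp only [mul_sub, Finset.sum_sub_distrib, ← Finset.sum_mul, hs1, one_mul, ← hμ₁, sub_self]
  · obtain ⟨φ, hφ, hE⟩ := exists_expTest_eq_sum_fst (n12 := n12) (n23 := n23) (n13 := n13)
      (corrMargin_nonneg hτ) (unifMargin_nonneg D.u_nonneg) sum_corrMargin
      (sum_unifMargin (D.sum_u hr)) hψ
    simp only [hE]
    refine (le_abs_self _).trans ((abs_sum_prod_sub_prod_mul_le h0 h1 hs0 hs1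
      (η := 2 * Real.exp (-(2 * M))) _ fun a b => ?_).trans ?_)
    · exact (D.abs_sum_update_block_le hr hδ0 (by linarith) hx h0 h1 hs0 hs1 hmom
        (Real.one_le_exp (by norm_num)) hφ a b).trans (sqrt_mixture_bound_le hmpos hn)
    · linarith

lemma exp_three_le : Real.exp 3 ≤ 21 := by
  have : Real.exp 3 = Real.exp 1 ^ 3 := by
    rw [← Real.exp_nat_mul]
    norm_num
  rw [this]
  calc Real.exp 1 ^ 3 ≤ 2.7182818286 ^ 3 := by
        gcongr
        exact Real.exp_one_lt_d9.le
    _ ≤ 21 := by norm_num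

lemma exists_forall_ge_log_sq_le : ∃ r₀ : ℕ, ∀ r ≥ r₀, 1920000 * Real.log r ^ 2 ≤ (r : ℝ) / 3 := by
  have h := ((Real.isLittleO_pow_log_id_atTop (n := 2)).comp_tendsto
    (tendsto_natCast_atTop_atTop (R := ℝ))).def (c := 1 / 5760000) (by norm_num)
  obtain ⟨r₀, hr₀⟩ := Filter.eventually_atTop.mp h
  refine ⟨r₀, fun r hr => ?_⟩
  have := hr₀ r hr
  simp only [Function.comp, id, Real.norm_eq_abs, abs_pow, sq_abs, Nat.abs_cast] at this
  linarith

lemma le_rhoStar_of_log_sq_le {r n12 : ℕ} (n23 n13 : ℕ) (hr : 5 ≤ r) (hn : 0 < n12)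
    (hlog : 1920000 * Real.log r ^ 2 ≤ (r : ℝ) / 3) :
    1 / 7200 * min (1 / Real.log r) √(r / (n12 * Real.log r)) ≤ rhoStar r n12 n23 n13 := by
  have hr' : (5 : ℝ) ≤ r := by exact_mod_cast hr
  have hn' : (0 : ℝ) < n12 := by exact_mod_cast hn
  have hL1 : 1 ≤ Real.log r := by
    rw [Real.le_log_iff_exp_le (by linarith)]
    linarith [Real.exp_one_lt_d9]
  set L := Real.log r with hL
  have hL0 : 0 < L := by linarith
  have hML : L ≤ (⌈L⌉₊ : ℝ) := Nat.le_ceil L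
  have hML2 : (⌈L⌉₊ : ℝ) ≤ 2 * L := by linarith [Nat.ceil_lt_add_one hL0.le]
  set M := ⌈L⌉₊ with hM
  have hM0 : 0 < M := Nat.ceil_pos.mpr hL0
  have hM' : (0 : ℝ) < M := by exact_mod_cast hM0
  have hm3 : (r : ℝ) / 3 ≤ (r / 2 : ℕ) := by
    have : r ≤ 3 * (r / 2) := by omega
    have : (r : ℝ) ≤ 3 * (r / 2 : ℕ) := by exact_mod_cast this
    linarith
  have hm2 : 2 * ((r / 2 : ℕ) : ℝ) ≤ r := by
    have : 2 * (r / 2) ≤ r := by omega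
    exact_mod_cast this
  set m : ℝ := ((r / 2 : ℕ) : ℝ) with hm
  have hm0 : 0 < m := by linarith
  set δ : ℝ := min (1 / 2) √(2 * M * m / (n12 * Real.exp 3)) with hδ
  have hδ0 : 0 ≤ δ := le_min (by norm_num) (Real.sqrt_nonneg _)
  have h := le_rhoStar_of_blocks (n12 := n12) n23 n13 (by omega : 2 ≤ r) hM0 hδ0 (min_le_left _ _)
    (by
      have : δ ^ 2 ≤ 2 * M * m / (n12 * Real.exp 3) := by
        rw [← Real.sq_sqrt (by positivity : 0 ≤ 2 * M * m / (n12 * Real.exp 3))]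
        exact pow_le_pow_left₀ hδ0 (min_le_right _ _) 2
      rw [le_div_iff₀ (by positivity)] at this
      linarith)
    (by
      have h1 : Real.exp (-(2 * M)) ≤ (r : ℝ)⁻¹ ^ 2 := by
        calc _ ≤ Real.exp (-(2 * L)) := Real.exp_le_exp.mpr (by linarith)
          _ = (Real.exp L)⁻¹ ^ 2 := by
              rw [← Real.exp_neg, ← Real.exp_nat_mul]
              congr 1
              push_cast
              ring
          _ = _ := by rw [hL, Real.exp_log (by linarith)]
      calc _ ≤ (r : ℝ) * (r : ℝ)⁻¹ ^ 2 := mul_le_mul hm2 h1 (Real.exp_pos _).le (by linarith)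
        _ = 1 / r := by field_simp
        _ ≤ 1 / 5 := one_div_le_one_div_of_le (by norm_num) hr')
    (by
      have : (M : ℝ) ^ 2 ≤ (2 * L) ^ 2 := pow_le_pow_left₀ hM'.le hML2 2
      have : (2 * L) ^ 2 = 4 * L ^ 2 := by ring
      linarith)
  refine le_trans ?_ h
  set Q := √(r / (n12 * L)) with hQ
  rw [le_div_iff₀ (by positivity)]
  refine le_min ?_ ?_
  · calc _ ≤ 1 / 7200 * (1 / L) * (600 * (2 * L)) := by
          gcongr
          exact min_le_left _ _
      _ ≤ 1 / 2 := by
          field_simp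
          norm_num
  · calc _ ≤ 1 / 7200 * Q * (600 * (2 * L)) := by
          gcongr
          exact min_le_right _ _
      _ = 1 / 6 * L * Q := by ring
      _ ≤ _ := by
          refine Real.le_sqrt_of_sq_le ?_
          rw [mul_pow, hQ, Real.sq_sqrt (by positivity), le_div_iff₀ (by positivity)]
          calc _ = L * (r / 3) * (Real.exp 3 / 12) := by
                field_simp
                norm_num
            _ ≤ M * m * 2 := by
                gcongr
                linarith [exp_three_le]
            _ = _ := by ring

lemma exists_mul_min_le_rhoStar : ∃ c : ℝ, 0 < c ∧ ∀ r n12 n23 n13 : ℕ, 2 ≤ r → 0 < n12 →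
    c * min (1 / Real.log r) √(r / (n12 * Real.log r)) ≤ rhoStar r n12 n23 n13 := by
  obtain ⟨r₀, hr₀⟩ := exists_forall_ge_log_sq_le
  set r₁ := max r₀ 5 with hr₁
  have hr₁0 : (0 : ℝ) < r₁ := by
    have : 0 < r₁ := by omega
    exact_mod_cast this
  have hlog2 : 0 < Real.log 2 := Real.log_pos (by norm_num)
  set B := √(r₁ / Real.log 2) with hB
  have hB0 : 0 < B := by positivity
  refine ⟨min (1 / 7200) (1 / 90 / B), by positivity, fun r n12 n23 n13 hr hn => ?_⟩
  have hr' : (2 : ℝ) ≤ r := by exact_mod_cast hr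
  have hlogr : Real.log 2 ≤ Real.log r := Real.log_le_log (by norm_num) hr'
  have hmin : 0 ≤ min (1 / Real.log r) √(r / (n12 * Real.log r)) :=
    le_min (one_div_nonneg.mpr (by linarith)) (Real.sqrt_nonneg _)
  rcases le_total r₁ r with h | h
  · exact (mul_le_mul_of_nonneg_right (min_le_left _ _) hmin).trans
      (le_rhoStar_of_log_sq_le n23 n13 (by omega) hn (hr₀ r (by omega)))
  · have hn' : (0 : ℝ) < n12 := by exact_mod_cast hn
    have h' : (r : ℝ) ≤ r₁ := by exact_mod_cast h
    refine le_trans ?_ (le_rhoStar_fst n23 n13 hr hn)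
    calc _ ≤ 1 / 90 / B * (B * (1 / √n12)) := by
          refine mul_le_mul (min_le_right _ _) ((min_le_right _ _).trans ?_) hmin (by positivity)
          rw [mul_one_div, hB, ← Real.sqrt_div (by positivity), div_div, mul_comm (Real.log 2)]
          gcongr
      _ = _ := by field_simp

/-- Theorem: minimax lower bound on `[r] × [2] × [2]`. -/
theorem statement_10 :
    ∃ c : ℝ, 0 < c ∧
      ∀ r n12 n23 n13 : ℕ, 2 ≤ r → 0 < n12 → 0 < n23 → 0 < n13 →
        c * max
            (min (1 / Real.log r)
              (Real.sqrt ((r : ℝ) / (((min n12 n13 : ℕ) : ℝ) * Real.log r))))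
            (1 / Real.sqrt ((min n12 (min n23 n13) : ℕ) : ℝ)) ≤
          rhoStar r n12 n23 n13 := by
  obtain ⟨c, hc, h⟩ := exists_mul_min_le_rhoStar
  refine ⟨min c (1 / 90), by positivity, fun r n12 n23 n13 hr h12 h23 h13 => ?_⟩
  have hlog : 0 ≤ Real.log r := Real.log_natCast_nonneg r
  rw [mul_max_of_nonneg _ _ (by positivity)]
  refine max_le ?_ ?_
  · refine (mul_le_mul_of_nonneg_right (min_le_left _ _)
      (le_min (one_div_nonneg.mpr hlog) (Real.sqrt_nonneg _))).trans ?_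
    rcases min_choice n12 n13 with e | e <;> rw [e]
    · exact h r n12 n23 n13 hr h12
    · rw [← rhoStar_swap]
      exact h r n13 n23 n12 hr h13
  · refine (mul_le_mul_of_nonneg_right (min_le_right _ _) (by positivity)).trans ?_
    rcases min_choice n12 (min n23 n13) with e | e <;> rw [e]
    · exact le_rhoStar_fst n23 n13 hr h12
    · rcases min_choice n23 n13 with e | e <;> rw [e]
      · exact le_rhoStar_snd n12 n13 hr h23
      · rw [← rhoStar_swap]
        exact le_rhoStar_fst n23 n12 hr h13
end

section
/- Let λ > 0, 0 ≤ M ≤ λ/2 and L ∈ ℕ. Let V and V' be real random variables supported on [λ/2 − M, λ/2 + M] with E(V^ℓ) = E((V')^ℓ) for all ℓ ∈ {1,…,L}. Let Q be the distribution on ℕ₀² of a pair (W_1, W_2) such that, conditionally on V = v, W_1 and W_2 are independent with W_1 ∼ Poisson(v) and W_2 ∼ Poisson(λ − v) (i.e. Q is the mixture of Poisson(v) ⊗ Poisson(λ−v) over the law of V), and define Q' analogously from V'. If L + 2 ≥ 8M²/λ, then d_TV(Q, Q') ≤ (2^{1/2}/π^{1/4}) · (2eM²/(λ(L+1)))^{(L+1)/2}.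 -/
open MeasureTheory

/-- The mass function on `ℕ₀²` of the pair `(W₁, W₂)` which, conditionally on `V = v` (with
`V ∼ μ`), has `W₁` and `W₂` independent with `W₁ ∼ Poi(v)` and `W₂ ∼ Poi(λ - v)`. -/
noncomputable def mixturePoissonPair (μ : Measure ℝ) (lam : ℝ) (w : ℕ × ℕ) : ℝ :=
  ∫ v, (Real.exp (-v) * v ^ w.1 / (Nat.factorial w.1 : ℝ)) *
    (Real.exp (-(lam - v)) * (lam - v) ^ w.2 / (Nat.factorial w.2 : ℝ)) ∂μ

/-- Total variation distance between two distributions on `ℕ₀²` given by mass functions: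
`d_TV(Q, Q') = sup_A |Q(A) - Q'(A)|`. -/
noncomputable def tvOfMass (q q' : ℕ × ℕ → ℝ) : ℝ :=
  sSup {t | ∃ A : Set (ℕ × ℕ), t = |∑' w, A.indicator (fun w => q w - q' w) w|}

/-- The product of the Poisson mass functions with equal parameters `lam / 2`. -/
noncomputable def poissonPairMass (lam : ℝ) (w : ℕ × ℕ) : ℝ :=
  Real.exp (-lam) * (lam / 2) ^ (w.1 + w.2) / (w.1.factorial * w.2.factorial)

lemma poissonPairMass_nonneg {lam : ℝ} (hlam : 0 ≤ lam) (w : ℕ × ℕ) :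
    0 ≤ poissonPairMass lam w := by
  unfold poissonPairMass; positivity

lemma hasSum_pow_div_factorial (x : ℝ) :
    HasSum (fun n : ℕ => x ^ n / n.factorial) (Real.exp x) := by
  rw [Real.exp_eq_exp_ℝ]
  exact NormedSpace.expSeries_div_hasSum_exp x

lemma hasSum_poissonPairMass_mul (lam u t : ℝ) :
    HasSum (fun w : ℕ × ℕ => poissonPairMass lam w * (u ^ w.1 * t ^ w.2))
      (Real.exp (-lam + lam / 2 * u + lam / 2 * t)) := by
  have h := ((hasSum_pow_div_factorial (lam / 2 * u)).mul (hasSum_pow_div_factorial (lam / 2 * t))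
    (summable_mul_of_summable_norm (Real.summable_pow_div_factorial _).norm
      (Real.summable_pow_div_factorial _).norm)).mul_left (Real.exp (-lam))
  rw [← Real.exp_add, ← Real.exp_add, ← add_assoc] at h
  refine h.congr_fun fun w => ?_
  simp only [poissonPairMass, mul_pow, pow_add]
  ring

/-- The likelihood ratio of the Poisson pair with parameters `lam / 2 * (1 ± s)`. -/
noncomputable def tiltFactor (s : ℝ) (w : ℕ × ℕ) : ℝ := (1 + s) ^ w.1 * (1 - s) ^ w.2

lemma continuous_tiltFactor (b : ℝ) (w : ℕ × ℕ) : Continuous fun x => tiltFactor (b * x) w := by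
  unfold tiltFactor; fun_prop

lemma abs_tiltFactor_le {s : ℝ} (hs : |s| ≤ 1) (w : ℕ × ℕ) :
    |tiltFactor s w| ≤ 2 ^ w.1 * 2 ^ w.2 := by
  obtain ⟨h1, h2⟩ := abs_le.1 hs
  rw [tiltFactor, abs_mul, abs_pow, abs_pow]
  gcongr <;> rw [abs_le] <;> constructor <;> linarith

lemma hasSum_poissonPairMass_mul_tiltFactor (lam s t : ℝ) :
    HasSum (fun w => poissonPairMass lam w * (tiltFactor s w * tiltFactor t w))
      (Real.exp (lam * (s * t))) := by
  convert hasSum_poissonPairMass_mul lam ((1 + s) * (1 + t)) ((1 - s) * (1 - t)) using 1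
  · ext w
    simp only [tiltFactor, mul_pow]
    ring
  · congr 1
    ring

lemma abs_mul_le_one_of_abs_le_one {b x : ℝ} (hb : |b| ≤ 1) (hx : |x| ≤ 1) : |b * x| ≤ 1 := by
  rw [abs_mul]
  exact mul_le_one₀ hb (abs_nonneg x) hx

lemma hasSum_integral_of_abs_le {Ω ι : Type*} [MeasurableSpace Ω] [Countable ι] (ρ : Measure Ω)
    [IsFiniteMeasure ρ] {F : ι → Ω → ℝ} {G : Ω → ℝ} {B : ι → ℝ} (hB : Summable B)
    (hF : ∀ i, AEStronglyMeasurable (F i) ρ) (hFB : ∀ᵐ ω ∂ρ, ∀ i, |F i ω| ≤ B i)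
    (hFG : ∀ᵐ ω ∂ρ, HasSum (fun i => F i ω) (G ω)) :
    HasSum (fun i => ∫ ω, F i ω ∂ρ) (∫ ω, G ω ∂ρ) :=
  hasSum_integral_of_dominated_convergence (fun i _ => B i) hF
    (fun i => hFB.mono fun _ h => h i) (ae_of_all _ fun _ => hB) (integrable_const _) hFG

lemma ae_prod_abs_le_one {κ ρ : Measure ℝ} [SFinite κ] [SFinite ρ]
    (hκ : ∀ᵐ x ∂κ, |x| ≤ 1) (hρ : ∀ᵐ x ∂ρ, |x| ≤ 1) :
    ∀ᵐ p ∂(κ.prod ρ), |p.1| ≤ 1 ∧ |p.2| ≤ 1 :=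
  (Measure.quasiMeasurePreserving_fst.ae hκ).and (Measure.quasiMeasurePreserving_snd.ae hρ)

section Kernel

variable {κ ρ : Measure ℝ} [IsProbabilityMeasure κ] [IsProbabilityMeasure ρ]

lemma hasSum_integral_tiltFactor {lam b : ℝ} (hlam : 0 ≤ lam) (hb : |b| ≤ 1)
    (hκ : ∀ᵐ x ∂κ, |x| ≤ 1) (hρ : ∀ᵐ x ∂ρ, |x| ≤ 1) :
    HasSum (fun w => poissonPairMass lam w *
        ((∫ x, tiltFactor (b * x) w ∂κ) * ∫ x, tiltFactor (b * x) w ∂ρ))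
      (∫ p, Real.exp (lam * (b * p.1 * (b * p.2))) ∂(κ.prod ρ)) := by
  simp only [← integral_prod_mul]
  simp only [← integral_const_mul]
  refine hasSum_integral_of_abs_le _ (hasSum_poissonPairMass_mul lam 4 4).summable
    (fun w => ?_) ?_ (ae_of_all _ fun p => hasSum_poissonPairMass_mul_tiltFactor _ _ _)
  · have := continuous_tiltFactor b w
    exact (((this.comp continuous_fst).mul (this.comp continuous_snd)).const_smul
      (poissonPairMass lam w)).aestronglyMeasurable
  · filter_upwards [ae_prod_abs_le_one hκ hρ] with p hp w
    rw [abs_mul, abs_of_nonneg (poissonPairMass_nonneg hlam w), abs_mul]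
    have h1 := abs_tiltFactor_le (abs_mul_le_one_of_abs_le_one hb hp.1) w
    have h2 := abs_tiltFactor_le (abs_mul_le_one_of_abs_le_one hb hp.2) w
    refine mul_le_mul_of_nonneg_left ((mul_le_mul h1 h2 (abs_nonneg _) (by positivity)).trans ?_)
      (poissonPairMass_nonneg hlam w)
    rw [show (4 : ℝ) = 2 * 2 by norm_num, mul_pow, mul_pow]
    exact le_of_eq (by ring)

lemma hasSum_integral_pow {lam b : ℝ} (hlam : 0 ≤ lam)
    (hκ : ∀ᵐ x ∂κ, |x| ≤ 1) (hρ : ∀ᵐ x ∂ρ, |x| ≤ 1) :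
    HasSum (fun m : ℕ => (lam * b ^ 2) ^ m / m.factorial *
        ((∫ x, x ^ m ∂κ) * ∫ x, x ^ m ∂ρ))
      (∫ p, Real.exp (lam * (b * p.1 * (b * p.2))) ∂(κ.prod ρ)) := by
  simp only [← integral_prod_mul]
  simp only [← integral_const_mul]
  refine hasSum_integral_of_abs_le _ (Real.summable_pow_div_factorial (lam * b ^ 2))
    (fun m => Continuous.aestronglyMeasurable (by fun_prop)) ?_ (ae_of_all _ fun p => ?_)
  · filter_upwards [ae_prod_abs_le_one hκ hρ] with p hp m
    have h1 : |p.1 ^ m * p.2 ^ m| ≤ 1 := by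
      rw [← mul_pow, abs_pow]
      exact pow_le_one₀ (abs_nonneg _) (abs_mul_le_one_of_abs_le_one hp.1 hp.2)
    rw [abs_mul, abs_of_nonneg (by positivity)]
    exact mul_le_of_le_one_right (by positivity) h1
  · refine (hasSum_pow_div_factorial (lam * (b * p.1 * (b * p.2)))).congr_fun fun m => ?_
    rw [show lam * (b * p.1 * (b * p.2)) = lam * b ^ 2 * (p.1 * p.2) by ring, mul_pow _ (p.1 * p.2),
      mul_pow p.1]
    ring

lemma hasSum_poissonPairMass_mul_integral_tiltFactor {lam b : ℝ} (hlam : 0 ≤ lam) (hb : |b| ≤ 1)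
    (hκ : ∀ᵐ x ∂κ, |x| ≤ 1) :
    HasSum (fun w => poissonPairMass lam w * ∫ x, tiltFactor (b * x) w ∂κ) 1 := by
  have h := hasSum_integral_tiltFactor (ρ := Measure.dirac 0) hlam hb hκ
    ((ae_dirac_iff (measurableSet_le (by fun_prop) (by fun_prop))).2 (by simp))
  have h0 :
      ∫ p : ℝ × ℝ, Real.exp (lam * (b * p.1 * (b * p.2))) ∂(κ.prod (Measure.dirac 0)) = 1 := by
    rw [Measure.prod_dirac, integral_map (by fun_prop)
      (Continuous.aestronglyMeasurable (by fun_prop))]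
    simp
  simpa [h0, tiltFactor] using h

/-- The chi-square type identity for the difference of two mixtures. -/
lemma hasSum_poissonPairMass_mul_sq {lam b : ℝ} (hlam : 0 ≤ lam) (hb : |b| ≤ 1)
    (hκ : ∀ᵐ x ∂κ, |x| ≤ 1) (hρ : ∀ᵐ x ∂ρ, |x| ≤ 1) {S : ℝ}
    (hS : HasSum (fun m : ℕ => (lam * b ^ 2) ^ m / m.factorial *
        ((∫ x, x ^ m ∂κ) - ∫ x, x ^ m ∂ρ) ^ 2) S) :
    HasSum (fun w => poissonPairMass lam w *
        ((∫ x, tiltFactor (b * x) w ∂κ) - ∫ x, tiltFactor (b * x) w ∂ρ) ^ 2) S := by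
  have h1 := ((hasSum_integral_tiltFactor hlam hb hκ hκ).add
    (hasSum_integral_tiltFactor hlam hb hρ hρ)).sub
    ((hasSum_integral_tiltFactor hlam hb hκ hρ).mul_left 2)
  have h2 := ((hasSum_integral_pow (b := b) hlam hκ hκ).add
    (hasSum_integral_pow (b := b) hlam hρ hρ)).sub
    ((hasSum_integral_pow (b := b) hlam hκ hρ).mul_left 2)
  have h3 := h2.congr_fun fun m => show (lam * b ^ 2) ^ m / m.factorial *
        ((∫ x, x ^ m ∂κ) - ∫ x, x ^ m ∂ρ) ^ 2 = _ by ring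
  rw [hS.unique h3]
  exact h1.congr_fun fun w => by ring

end Kernel

section Moments

open Polynomial

/-- The difference of the integrals of `f` against two measures. -/
noncomputable def integralDiff (κ ρ : Measure ℝ) (f : ℝ → ℝ) : ℝ := ∫ x, f x ∂κ - ∫ x, f x ∂ρ

lemma integralDiff_eval_eq_zero {κ ρ : Measure ℝ} (hκ : ∀ m : ℕ, Integrable (fun x => x ^ m) κ)
    (hρ : ∀ m : ℕ, Integrable (fun x => x ^ m) ρ) {n : ℕ}
    (hmom : ∀ m < n, integralDiff κ ρ (fun x => x ^ m) = 0) {P : ℝ[X]} (hP : P.natDegree < n) :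
    integralDiff κ ρ (fun x => P.eval x) = 0 := by
  have hi {θ : Measure ℝ} (hθ : ∀ m : ℕ, Integrable (fun x => x ^ m) θ) :
      ∫ x, P.eval x ∂θ = ∑ i ∈ Finset.range n, P.coeff i * ∫ x, x ^ i ∂θ := by
    simp only [P.eval_eq_sum_range' hP]
    rw [integral_finsetSum _ fun i _ => (hθ i).const_mul _]
    simp only [integral_const_mul]
  rw [integralDiff, hi hκ, hi hρ, ← Finset.sum_sub_distrib]
  refine Finset.sum_eq_zero fun i h => ?_
  rw [← mul_sub]
  exact mul_eq_zero_of_right _ (hmom i (Finset.mem_range.1 h))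

variable {κ ρ : Measure ℝ} [IsProbabilityMeasure κ] [IsProbabilityMeasure ρ]

lemma integrable_of_continuous_of_abs_le (hκ : ∀ᵐ x ∂κ, |x| ≤ 1) {f : ℝ → ℝ} (hf : Continuous f) :
    Integrable f κ := by
  obtain ⟨C, hC⟩ := (isCompact_Icc (a := (-1 : ℝ)) (b := 1)).exists_bound_of_continuousOn
    hf.continuousOn
  exact Integrable.of_bound hf.aestronglyMeasurable C (hκ.mono fun x hx => hC x (abs_le.1 hx))

lemma abs_integral_le_one (hκ : ∀ᵐ x ∂κ, |x| ≤ 1) {f : ℝ → ℝ} (hf : ∀ x, |x| ≤ 1 → |f x| ≤ 1) :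
    |∫ x, f x ∂κ| ≤ 1 := by
  simpa using norm_integral_le_of_norm_le_const (f := f) (C := 1) (hκ.mono hf)

lemma abs_integralDiff_le_two (hκ : ∀ᵐ x ∂κ, |x| ≤ 1) (hρ : ∀ᵐ x ∂ρ, |x| ≤ 1) {f : ℝ → ℝ}
    (hf : ∀ x, |x| ≤ 1 → |f x| ≤ 1) : |integralDiff κ ρ f| ≤ 2 := by
  have h := abs_sub (∫ x, f x ∂κ) (∫ x, f x ∂ρ)
  rw [integralDiff]
  linarith [abs_integral_le_one hκ hf, abs_integral_le_one hρ hf]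

lemma abs_pow_le_one_of_abs_le_one (m : ℕ) (x : ℝ) (hx : |x| ≤ 1) : |x ^ m| ≤ 1 := by
  rw [abs_pow]
  exact pow_le_one₀ (abs_nonneg x) hx

lemma abs_integralDiff_even_pow_le_one (hκ : ∀ᵐ x ∂κ, |x| ≤ 1) (hρ : ∀ᵐ x ∂ρ, |x| ≤ 1) {m : ℕ}
    (hm : Even m) : |integralDiff κ ρ (fun x => x ^ m)| ≤ 1 := by
  have h1 := (abs_le.1 (abs_integral_le_one hκ (abs_pow_le_one_of_abs_le_one m))).2
  have h2 := (abs_le.1 (abs_integral_le_one hρ (abs_pow_le_one_of_abs_le_one m))).2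
  have h3 : 0 ≤ ∫ x, x ^ m ∂κ := integral_nonneg fun x => hm.pow_nonneg x
  have h4 : 0 ≤ ∫ x, x ^ m ∂ρ := integral_nonneg fun x => hm.pow_nonneg x
  rw [integralDiff, abs_le]
  constructor <;> linarith

/-- Chernoff bound for the Chebyshev expansion of `x ^ m * T k`. -/
lemma abs_integralDiff_pow_mul_T_le (hκ : ∀ᵐ x ∂κ, |x| ≤ 1) (hρ : ∀ᵐ x ∂ρ, |x| ≤ 1) {n : ℕ}
    (hmom : ∀ m < n, integralDiff κ ρ (fun x => x ^ m) = 0) {r : ℝ} (hr : 1 ≤ r) (m : ℕ) (k : ℤ) :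
    |integralDiff κ ρ (fun x => x ^ m * (Chebyshev.T ℝ k).eval x)| ≤
      2 * ((r + r⁻¹) / 2) ^ m * (r ^ k + r ^ (-k)) / r ^ n := by
  have hr0 : 0 < r := by linarith
  induction m generalizing k with
  | zero =>
    simp only [pow_zero, one_mul, mul_one]
    by_cases hk : k.natAbs < n
    · rw [integralDiff_eval_eq_zero
        (fun m => integrable_of_continuous_of_abs_le hκ (continuous_pow m))
        (fun m => integrable_of_continuous_of_abs_le hρ (continuous_pow m)) hmom
        (by rwa [Chebyshev.natDegree_T])]
      simp only [abs_zero]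
      positivity
    · refine (abs_integralDiff_le_two hκ hρ fun x hx =>
        Chebyshev.abs_eval_T_real_le_one k hx).trans ?_
      rw [mul_div_assoc]
      refine le_mul_of_one_le_right zero_le_two ((one_le_div (by positivity)).2 ?_)
      have h1 : r ^ n ≤ r ^ k.natAbs := pow_le_pow_right₀ hr (not_lt.1 hk)
      have h2 : 0 < r ^ k := by positivity
      have h3 : 0 < r ^ (-k) := by positivity
      rcases Int.natAbs_eq k with h | h
      · have : r ^ k = r ^ k.natAbs := by rw [← zpow_natCast, ← h]
        linarith
      · have : r ^ (-k) = r ^ k.natAbs := by rw [← zpow_natCast, h]; simp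
        linarith
  | succ m ih =>
    have hi {θ : Measure ℝ} [IsProbabilityMeasure θ] (hθ : ∀ᵐ x ∂θ, |x| ≤ 1) :
        ∫ x, x ^ (m + 1) * (Chebyshev.T ℝ k).eval x ∂θ =
          ((∫ x, x ^ m * (Chebyshev.T ℝ (k + 1)).eval x ∂θ) +
            ∫ x, x ^ m * (Chebyshev.T ℝ (k - 1)).eval x ∂θ) / 2 := by
      rw [← integral_add (integrable_of_continuous_of_abs_le hθ (by fun_prop))
        (integrable_of_continuous_of_abs_le hθ (by fun_prop)), ← integral_div]
      congr 1
      ext x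
      rw [Chebyshev.T_add_one]
      simp only [eval_sub, eval_mul, eval_ofNat, eval_X]
      ring
    have h1 := ih (k + 1)
    have h2 := ih (k - 1)
    have h3 : integralDiff κ ρ (fun x => x ^ (m + 1) * (Chebyshev.T ℝ k).eval x) =
        (integralDiff κ ρ (fun x => x ^ m * (Chebyshev.T ℝ (k + 1)).eval x) +
          integralDiff κ ρ (fun x => x ^ m * (Chebyshev.T ℝ (k - 1)).eval x)) / 2 := by
      simp only [integralDiff, hi hκ, hi hρ]
      ring
    have h4 : 2 * ((r + r⁻¹) / 2) ^ (m + 1) * (r ^ k + r ^ (-k)) / r ^ n =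
        (2 * ((r + r⁻¹) / 2) ^ m * (r ^ (k + 1) + r ^ (-(k + 1))) / r ^ n +
          2 * ((r + r⁻¹) / 2) ^ m * (r ^ (k - 1) + r ^ (-(k - 1))) / r ^ n) / 2 := by
      have e1 : r ^ (k + 1) = r ^ k * r := zpow_add_one₀ hr0.ne' k
      have e2 : r ^ (-(k + 1)) = r ^ (-k) * r⁻¹ := by
        rw [neg_add, ← sub_eq_add_neg, zpow_sub_one₀ hr0.ne']
      have e3 : r ^ (k - 1) = r ^ k * r⁻¹ := zpow_sub_one₀ hr0.ne' k
      have e4 : r ^ (-(k - 1)) = r ^ (-k) * r := by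
        rw [neg_sub, sub_eq_neg_add, zpow_add_one₀ hr0.ne']
      rw [e1, e2, e3, e4, pow_succ]
      ring
    rw [h3, h4, abs_div, abs_two]
    have h5 := abs_add_le (integralDiff κ ρ (fun x => x ^ m * (Chebyshev.T ℝ (k + 1)).eval x))
      (integralDiff κ ρ (fun x => x ^ m * (Chebyshev.T ℝ (k - 1)).eval x))
    linarith

lemma abs_integralDiff_pow_le (hκ : ∀ᵐ x ∂κ, |x| ≤ 1) (hρ : ∀ᵐ x ∂ρ, |x| ≤ 1) {n : ℕ}
    (hmom : ∀ m < n, integralDiff κ ρ (fun x => x ^ m) = 0) {r : ℝ} (hr : 1 ≤ r) (m : ℕ) :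
    |integralDiff κ ρ (fun x => x ^ m)| ≤ 4 * ((r + r⁻¹) / 2) ^ m / r ^ n := by
  have h := abs_integralDiff_pow_mul_T_le hκ hρ hmom hr m 0
  simp only [Chebyshev.T_zero, eval_one, mul_one, neg_zero, zpow_zero] at h
  exact h.trans_eq (by ring)

lemma abs_integralDiff_cube_le (hκ : ∀ᵐ x ∂κ, |x| ≤ 1) (hρ : ∀ᵐ x ∂ρ, |x| ≤ 1)
    (h1 : integralDiff κ ρ (fun x => x ^ 1) = 0) :
    |integralDiff κ ρ (fun x => x ^ 3)| ≤ 1 / 2 := by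
  have hb := abs_integralDiff_le_two hκ hρ (f := fun x => 4 * x ^ 3 - 3 * x ^ 1) fun x hx => by
    obtain ⟨h1, h2⟩ := abs_le.1 hx
    rw [abs_le]
    constructor <;> nlinarith [mul_nonneg (sub_nonneg.2 h2) (sq_nonneg (2 * x + 1)),
      mul_nonneg (neg_le_iff_add_nonneg.1 h1) (sq_nonneg (2 * x - 1))]
  have hi {θ : Measure ℝ} [IsProbabilityMeasure θ] (hθ : ∀ᵐ x ∂θ, |x| ≤ 1) :
      ∫ x, (4 * x ^ 3 - 3 * x ^ 1) ∂θ = 4 * ∫ x, x ^ 3 ∂θ - 3 * ∫ x, x ^ 1 ∂θ := by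
    rw [integral_sub (integrable_of_continuous_of_abs_le hθ (by fun_prop))
      (integrable_of_continuous_of_abs_le hθ (by fun_prop)), integral_const_mul,
      integral_const_mul]
  unfold integralDiff at *
  rw [hi hκ, hi hρ] at hb
  rw [abs_le] at *
  constructor <;> linarith [hb.1, hb.2]

end Moments

lemma four_mul_exp_le {a : ℝ} (ha : 0 < a) {n : ℕ} (hn : 4 ≤ n) (han : a ≤ (n + 1) / 2) :
    4 * Real.exp (a / 2 + a ^ 2 / (16 * n)) ≤ 1.12 * 2 ^ n := by
  have hn' : (4 : ℝ) ≤ n := by exact_mod_cast hn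
  have h1 : a / 2 + a ^ 2 / (16 * n) ≤ (n + 1 : ℕ) * 0.27 := by
    have h2 : a ^ 2 ≤ ((n + 1) / 2 : ℝ) ^ 2 := by gcongr
    have h3 : a ^ 2 / (16 * n) ≤ 5 / 256 * (n + 1) := by
      rw [div_le_iff₀ (by positivity)]
      nlinarith
    push_cast
    linarith
  have h2 : Real.exp 0.27 ≤ 1.31 := by
    have := Real.exp_bound' (x := 0.27) (by norm_num) (by norm_num) (n := 6) (by norm_num)
    refine this.trans ?_
    norm_num [Finset.sum_range_succ, Nat.factorial]
  have h3 : Real.exp (a / 2 + a ^ 2 / (16 * n)) ≤ 1.31 ^ (n + 1) := by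
    refine (Real.exp_le_exp.2 h1).trans ?_
    rw [Real.exp_nat_mul]
    gcongr
  have h4 (k : ℕ) (hk : 4 ≤ k) : 4 * (1.31 : ℝ) ^ (k + 1) ≤ 1.12 * 2 ^ k := by
    induction k, hk using Nat.le_induction with
    | base => norm_num
    | succ k hk ih =>
      have : (0 : ℝ) < 1.31 ^ (k + 1) := by positivity
      rw [pow_succ, pow_succ (2 : ℝ)]
      linarith
  linarith [h4 n hn]

lemma exp_three_halves_le : Real.exp (3 / 2) ≤ 4.4818 := by
  have h : Real.exp (3 / 2) = Real.exp (3/4) ^ 2 := by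
    rw [← Real.exp_nat_mul]; norm_num
  have h2 : Real.exp (3/4) ≤ 2.11701 := by
    have := Real.exp_bound' (x := 3/4) (by norm_num) (by norm_num) (n := 8) (by norm_num)
    refine this.trans ?_
    norm_num [Finset.sum_range_succ, Nat.factorial]
  rw [h]
  refine (pow_le_pow_left₀ (Real.exp_pos _).le h2 2).trans ?_
  norm_num

/-- Evaluation of the Chernoff bound at the optimal rate `r ^ 2 = 4 * n / a`. -/
lemma tsum_pow_div_factorial_mul_sq_le_of_four_le {a : ℝ} (ha : 0 < a) {n : ℕ} (hn : 4 ≤ n)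
    (han : a ≤ (n + 1) / 2) {y : ℕ → ℝ}
    (hy : ∀ r : ℝ, 1 ≤ r → ∀ m, |y m| ≤ 4 * ((r + r⁻¹) / 2) ^ m / r ^ n) {S : ℝ}
    (hS : HasSum (fun m : ℕ => a ^ m / m.factorial * y m ^ 2) S) :
    S ≤ 4 * (1.12 * (a * Real.exp 1 / (2 * n)) ^ n) := by
  have hn' : (4 : ℝ) ≤ n := by exact_mod_cast hn
  have hn0 : (n : ℝ) ≠ 0 := by positivity
  obtain ⟨r, hr, hr2⟩ : ∃ r : ℝ, 1 ≤ r ∧ r ^ 2 = 4 * n / a := by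
    refine ⟨√(4 * n / a), Real.one_le_sqrt.2 ?_, Real.sq_sqrt (by positivity)⟩
    rw [one_le_div ha]
    linarith
  set c := (r + r⁻¹) / 2 with hc
  have hr0 : r ≠ 0 := by positivity
  have hac : a * c ^ 2 = n + (a / 2 + a ^ 2 / (16 * n)) := by
    have : c ^ 2 = (r ^ 2 + 2 + (r ^ 2)⁻¹) / 4 := by
      rw [hc]
      field_simp
      ring
    rw [this, hr2]
    field_simp
    ring
  have hterm (m : ℕ) : a ^ m / m.factorial * y m ^ 2 ≤
      16 / (r ^ 2) ^ n * ((a * c ^ 2) ^ m / m.factorial) := by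
    have h1 : y m ^ 2 ≤ (4 * c ^ m / r ^ n) ^ 2 := sq_le_sq' (abs_le.1 (hy r hr m)).1
      (abs_le.1 (hy r hr m)).2
    refine (mul_le_mul_of_nonneg_left h1 (by positivity)).trans_eq ?_
    rw [mul_pow, ← pow_mul c, ← pow_mul r, div_pow, mul_pow, ← pow_mul, ← pow_mul, mul_comm n,
      mul_comm m]
    ring
  have h := hasSum_le hterm hS ((hasSum_pow_div_factorial (a * c ^ 2)).mul_left _)
  have hexp := four_mul_exp_le ha hn han
  have he : Real.exp n = Real.exp 1 ^ n := by rw [← Real.exp_nat_mul, mul_one]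
  rw [hac, Real.exp_add, hr2, he] at h
  refine h.trans ?_
  calc 16 / (4 * n / a) ^ n * (Real.exp 1 ^ n * Real.exp (a / 2 + a ^ 2 / (16 * n)))
      = 4 * (a * Real.exp 1 / (4 * n)) ^ n * (4 * Real.exp (a / 2 + a ^ 2 / (16 * n))) := by
        rw [div_pow, div_pow, mul_pow a]
        field_simp
        ring
    _ ≤ 4 * (a * Real.exp 1 / (4 * n)) ^ n * (1.12 * 2 ^ n) := by gcongr
    _ = 4 * (1.12 * (a * Real.exp 1 / (4 * n) * 2) ^ n) := by rw [mul_pow _ (2 : ℝ)]; ring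
    _ = _ := by congr 3; field_simp; ring

lemma tsum_pow_div_factorial_mul_sq_le_of_le_three {a : ℝ} (ha : 0 ≤ a) {n : ℕ} (hn0 : 1 ≤ n)
    (hn : n ≤ 3) (han : a ≤ (n + 1) / 2) {y : ℕ → ℝ} (hy0 : ∀ m < n, y m = 0)
    (hy : ∀ m, y m ^ 2 ≤ 4) (hy2 : y 2 ^ 2 ≤ 1) (hy3 : n = 3 → y 3 ^ 2 ≤ 1 / 4)
    (hy4 : y 4 ^ 2 ≤ 1) {S : ℝ}
    (hS : HasSum (fun m : ℕ => a ^ m / m.factorial * y m ^ 2) S) :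
    S ≤ 4 * (1.12 * (a * Real.exp 1 / (2 * n)) ^ n) := by
  set A : ℝ := (n + 1) / 2 with hA
  have hA0 : 0 < A := by positivity
  have hsum : Summable fun m : ℕ => A ^ m / m.factorial * y m ^ 2 :=
    Summable.of_nonneg_of_le (fun m => by positivity)
      (fun m => mul_le_mul_of_nonneg_left (hy m) (by positivity))
      ((hasSum_pow_div_factorial A).summable.mul_right 4)
  have hterm (m : ℕ) : a ^ m / m.factorial * y m ^ 2 ≤
      (a / A) ^ n * (A ^ m / m.factorial * y m ^ 2) := by
    rcases lt_or_ge m n with hm | hm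
    · simp [hy0 m hm]
    · obtain ⟨k, rfl⟩ := Nat.exists_eq_add_of_le hm
      have : a ^ (n + k) ≤ (a / A) ^ n * A ^ (n + k) := by
        rw [pow_add, pow_add, ← mul_assoc, ← mul_pow, div_mul_cancel₀ _ hA0.ne']
        gcongr
      rw [← mul_assoc, ← mul_div_assoc]
      gcongr
  have h1 := hasSum_le hterm hS (hsum.hasSum.mul_left _)
  have h2 : ∑ m ∈ Finset.range 5, A ^ m / m.factorial * (4 - y m ^ 2) ≤
      4 * Real.exp A - ∑' m : ℕ, A ^ m / m.factorial * y m ^ 2 := by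
    have h3 := ((hasSum_pow_div_factorial A).mul_left 4).sub hsum.hasSum
    refine sum_le_hasSum _ (fun m _ => mul_nonneg (by positivity) (sub_nonneg.2 (hy m)))
      (h3.congr_fun fun m => by ring)
  have he := Real.exp_one_gt_d9
  have he' := Real.exp_one_lt_d9
  suffices h : ∑' m : ℕ, A ^ m / m.factorial * y m ^ 2 ≤
      4 * (1.12 * (A * Real.exp 1 / (2 * n)) ^ n) by
    refine h1.trans ((mul_le_mul_of_nonneg_left h (by positivity)).trans_eq ?_)
    rw [mul_left_comm, mul_left_comm _ (1.12 : ℝ), ← mul_pow]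
    congr 3
    field_simp
  simp only [Finset.sum_range_succ, Finset.sum_range_zero, Nat.factorial] at h2
  interval_cases n
  · have e : A = 1 := by rw [hA]; norm_num
    rw [e] at h2 ⊢
    norm_num [hy0 0] at h2 ⊢
    nlinarith [hy 1, hy 3]
  · have e : A = 3 / 2 := by rw [hA]; norm_num
    have h5 := exp_three_halves_le
    rw [e] at h2 ⊢
    norm_num [hy0 0, hy0 1] at h2 ⊢
    nlinarith [hy 3]
  · have e : A = 2 := by rw [hA]; norm_num
    have h5 : Real.exp 2 = Real.exp 1 ^ 2 := by rw [← Real.exp_nat_mul]; norm_num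
    have h6 : Real.exp 1 ^ 2 ≤ 7.3891 := by nlinarith
    have h7 : (2.7182818 : ℝ) ^ 3 ≤ Real.exp 1 ^ 3 := by gcongr; linarith
    rw [e, h5] at h2
    rw [e]
    norm_num [hy0 0, hy0 1, hy0 2, div_pow, mul_pow] at h2 h7 ⊢
    linarith [hy3 rfl]

/-- Half the `ℓ¹` norm controls total variation, and is controlled by the chi-square sum. -/
lemma abs_tsum_indicator_le {ι : Type*} {B f : ι → ℝ} {S R : ℝ} (hB : ∀ w, 0 ≤ B w)
    (hB1 : HasSum B 1) (hf : HasSum (fun w => B w * f w) 0)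
    (hf2 : HasSum (fun w => B w * f w ^ 2) S) (hR : 0 ≤ R) (hS : S ≤ 4 * R ^ 2) (A : Set ι) :
    |∑' w, A.indicator (fun w => B w * f w) w| ≤ R := by
  refine le_of_forall_pos_le_add fun ε hε => ?_
  have hR' : 0 < R + ε := by positivity
  have hle (w : ι) : |B w * f w| ≤ (R + ε) * B w + (4 * (R + ε))⁻¹ * (B w * f w ^ 2) := by
    have h : |f w| ≤ (R + ε) + (4 * (R + ε))⁻¹ * f w ^ 2 := by
      rw [inv_mul_eq_div, ← sub_le_iff_le_add', le_div_iff₀ (by positivity), ← sq_abs (f w)]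
      nlinarith [sq_nonneg (|f w| - 2 * (R + ε))]
    rw [abs_mul, abs_of_nonneg (hB w)]
    nlinarith [mul_le_mul_of_nonneg_left h (hB w)]
  have hbound := (hB1.mul_left (R + ε)).add (hf2.mul_left (4 * (R + ε))⁻¹)
  have hsum : Summable fun w => |B w * f w| :=
    Summable.of_nonneg_of_le (fun _ => abs_nonneg _) hle hbound.summable
  have h1 := hasSum_le hle hsum.hasSum hbound
  have h2 := ((hf.summable.indicator A).hasSum.mul_left 2).sub hf
  have h3 : |2 * ∑' w, A.indicator (fun w => B w * f w) w - 0| ≤ ∑' w, |B w * f w| := by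
    rw [← h2.tsum_eq, ← Real.norm_eq_abs]
    refine tsum_of_norm_bounded hsum.hasSum fun w => ?_
    by_cases hw : w ∈ A
    · simp only [Set.indicator_of_mem hw, Real.norm_eq_abs]
      exact le_of_eq (by congr 1; ring)
    · simp [Set.indicator_of_notMem hw]
  have h4 : (4 * (R + ε))⁻¹ * S ≤ R + ε := by
    rw [inv_mul_le_iff₀ (by positivity)]
    nlinarith
  rw [sub_zero, abs_mul, abs_two] at h3
  linarith

section Standardize

variable {lam M : ℝ} {μ : Measure ℝ}

/-- The law of `(V - lam / 2) / M` for `V ∼ μ`. -/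
noncomputable def standardize (lam M : ℝ) (μ : Measure ℝ) : Measure ℝ :=
  μ.map fun v => (v - lam / 2) / M

instance [IsProbabilityMeasure μ] : IsProbabilityMeasure (standardize lam M μ) :=
  Measure.isProbabilityMeasure_map (by fun_prop)

lemma ae_standardize_abs_le_one (hM0 : 0 ≤ M)
    (hμ : ∀ᵐ v ∂μ, v ∈ Set.Icc (lam / 2 - M) (lam / 2 + M)) :
    ∀ᵐ x ∂(standardize lam M μ), |x| ≤ 1 := by
  rw [standardize, ae_map_iff (by fun_prop) (measurableSet_le (by fun_prop) (by fun_prop))]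
  filter_upwards [hμ] with v hv
  rw [abs_div, abs_of_nonneg hM0]
  refine div_le_one_of_le₀ (abs_le.2 ?_) hM0
  constructor <;> linarith [hv.1, hv.2]

lemma mixturePoissonPair_eq (hlam : 0 < lam)
    (hμ : ∀ᵐ v ∂μ, v ∈ Set.Icc (lam / 2 - M) (lam / 2 + M)) (w : ℕ × ℕ) :
    mixturePoissonPair μ lam w =
      poissonPairMass lam w * ∫ x, tiltFactor (2 * M / lam * x) w ∂(standardize lam M μ) := by
  rw [standardize, integral_map (by fun_prop) (continuous_tiltFactor _ w).aestronglyMeasurable,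
    ← integral_const_mul, mixturePoissonPair]
  refine integral_congr_ae (hμ.mono fun v hv => ?_)
  obtain ⟨t, ht⟩ : ∃ t, t = 2 * M / lam * ((v - lam / 2) / M) := ⟨_, rfl⟩
  have hv' : v = lam / 2 * (1 + t) := by
    rw [ht]
    rcases eq_or_ne M 0 with rfl | hM
    · simp only [sub_zero, add_zero, Set.Icc_self, Set.mem_singleton_iff] at hv
      simp [hv]
    · field_simp
      ring
  have hv'' : lam - v = lam / 2 * (1 - t) := by rw [hv']; ring
  have he : Real.exp (-v) * Real.exp (-(lam - v)) = Real.exp (-lam) := by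
    rw [← Real.exp_add]
    congr 1
    ring
  simp only
  rw [← ht, poissonPairMass, tiltFactor, ← he]
  generalize Real.exp (-v) = p
  generalize Real.exp (-(lam - v)) = q
  rw [hv'', hv', mul_pow, mul_pow, pow_add]
  ring

lemma integrable_pow_of_ae_mem_Icc [IsFiniteMeasure μ] {p q : ℝ}
    (hμ : ∀ᵐ v ∂μ, v ∈ Set.Icc p q) (m : ℕ) : Integrable (fun v => v ^ m) μ := by
  obtain ⟨C, hC⟩ := (isCompact_Icc (a := p) (b := q)).exists_bound_of_continuousOn
    (continuous_pow m).continuousOn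
  exact Integrable.of_bound (continuous_pow m).aestronglyMeasurable C (hμ.mono hC)

open Polynomial in
lemma integralDiff_standardize_pow_eq_zero {μ' : Measure ℝ}
    (hμ : ∀ m : ℕ, Integrable (fun v => v ^ m) μ) (hμ' : ∀ m : ℕ, Integrable (fun v => v ^ m) μ')
    {n : ℕ} (hmom : ∀ m < n, integralDiff μ μ' (fun v => v ^ m) = 0) {m : ℕ} (hm : m < n) :
    integralDiff (standardize lam M μ) (standardize lam M μ') (fun x => x ^ m) = 0 := by
  have hmeas : Measurable fun v : ℝ => (v - lam / 2) / M := by fun_prop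
  rw [integralDiff, standardize, standardize, integral_map hmeas.aemeasurable (by fun_prop),
    integral_map hmeas.aemeasurable (by fun_prop)]
  have hP : (((X - C (lam / 2)) * C M⁻¹) ^ m : ℝ[X]).natDegree < n := by
    have h1 : ((X - C (lam / 2)) * C M⁻¹ : ℝ[X]).natDegree ≤ 1 :=
      (natDegree_mul_C_le _ _).trans (natDegree_X_sub_C_le _)
    exact (natDegree_pow_le_of_le m h1).trans_lt (by simpa using hm)
  have h := integralDiff_eval_eq_zero hμ hμ' hmom hP
  simpa [integralDiff, div_eq_mul_inv] using h

end Standardize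

lemma abs_tsum_indicator_mixturePoissonPair_sub_le {lam M : ℝ} (hlam : 0 < lam) (hM0 : 0 ≤ M)
    (hM : M ≤ lam / 2) {μ μ' : Measure ℝ} [IsProbabilityMeasure μ] [IsProbabilityMeasure μ']
    (hμ : ∀ᵐ v ∂μ, v ∈ Set.Icc (lam / 2 - M) (lam / 2 + M))
    (hμ' : ∀ᵐ v ∂μ', v ∈ Set.Icc (lam / 2 - M) (lam / 2 + M)) {n : ℕ} (hn : 1 ≤ n)
    (hmom : ∀ m < n, integralDiff μ μ' (fun v => v ^ m) = 0)
    (hMn : 4 * M ^ 2 / lam ≤ (n + 1) / 2) {R : ℝ} (hR : 0 ≤ R)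
    (hRn : 1.12 * (4 * M ^ 2 / lam * Real.exp 1 / (2 * n)) ^ n ≤ R ^ 2) (A : Set (ℕ × ℕ)) :
    |∑' w, A.indicator (fun w => mixturePoissonPair μ lam w - mixturePoissonPair μ' lam w) w| ≤
      R := by
  set κ := standardize lam M μ
  set ρ := standardize lam M μ'
  have hκ : ∀ᵐ x ∂κ, |x| ≤ 1 := ae_standardize_abs_le_one hM0 hμ
  have hρ : ∀ᵐ x ∂ρ, |x| ≤ 1 := ae_standardize_abs_le_one hM0 hμ'
  have hb : |2 * M / lam| ≤ 1 := by
    rw [abs_of_nonneg (by positivity), div_le_one hlam]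
    linarith
  have ha : lam * (2 * M / lam) ^ 2 = 4 * M ^ 2 / lam := by
    field_simp
    ring
  have hmom' : ∀ m < n, integralDiff κ ρ (fun x => x ^ m) = 0 := fun m hm =>
    integralDiff_standardize_pow_eq_zero (integrable_pow_of_ae_mem_Icc hμ)
      (integrable_pow_of_ae_mem_Icc hμ') hmom hm
  have hy (m : ℕ) : integralDiff κ ρ (fun x => x ^ m) ^ 2 ≤ 4 := by
    rw [show (4 : ℝ) = 2 ^ 2 by norm_num, ← sq_abs]
    gcongr
    exact abs_integralDiff_le_two hκ hρ (abs_pow_le_one_of_abs_le_one m)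
  have hyEven {m : ℕ} (hm : Even m) : integralDiff κ ρ (fun x => x ^ m) ^ 2 ≤ 1 :=
    (sq_le_one_iff_abs_le_one _).2 (abs_integralDiff_even_pow_le_one hκ hρ hm)
  have ha0 : 0 ≤ 4 * M ^ 2 / lam := by positivity
  have hS : Summable fun m : ℕ => (4 * M ^ 2 / lam) ^ m / m.factorial *
      integralDiff κ ρ (fun x => x ^ m) ^ 2 :=
    Summable.of_nonneg_of_le (fun m => by positivity)
      (fun m => mul_le_mul_of_nonneg_left (hy m) (by positivity))
      ((hasSum_pow_div_factorial _).summable.mul_right 4)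
  have hSle : ∑' m : ℕ, (4 * M ^ 2 / lam) ^ m / m.factorial *
      integralDiff κ ρ (fun x => x ^ m) ^ 2 ≤ 4 * R ^ 2 := by
    refine le_trans ?_ (mul_le_mul_of_nonneg_left hRn zero_le_four)
    rcases le_or_gt n 3 with h3 | h3
    · refine tsum_pow_div_factorial_mul_sq_le_of_le_three ha0 hn h3 hMn hmom' hy
        (hyEven (by decide)) ?_ (hyEven (by decide)) hS.hasSum
      rintro rfl
      rw [show (1 / 4 : ℝ) = (1 / 2) ^ 2 by norm_num, ← sq_abs]
      gcongr
      exact abs_integralDiff_cube_le hκ hρ (hmom' 1 (by norm_num))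
    · rcases ha0.eq_or_lt with h0 | h0
      · have hz (m : ℕ) : (4 * M ^ 2 / lam) ^ m / m.factorial *
            integralDiff κ ρ (fun x => x ^ m) ^ 2 = 0 := by
          rcases m.eq_zero_or_pos with rfl | hm
          · rw [hmom' 0 (by omega)]
            simp
          · rw [← h0, zero_pow hm.ne']
            simp
        simp only [hz, tsum_zero]
        positivity
      · exact tsum_pow_div_factorial_mul_sq_le_of_four_le h0 h3 hMn
          (fun r hr m => abs_integralDiff_pow_le hκ hρ hmom' hr m) hS.hasSum
  have hB1 : HasSum (poissonPairMass lam) 1 := by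
    have h := hasSum_poissonPairMass_mul lam 1 1
    simpa [add_assoc] using h
  have hf := (hasSum_poissonPairMass_mul_integral_tiltFactor hlam.le hb hκ).sub
    (hasSum_poissonPairMass_mul_integral_tiltFactor hlam.le hb hρ)
  simp only [← mul_sub, sub_self] at hf
  rw [← ha] at hS hSle
  have hf2 := hasSum_poissonPairMass_mul_sq hlam.le hb hκ hρ hS.hasSum
  simp only [mixturePoissonPair_eq hlam hμ, mixturePoissonPair_eq hlam hμ', ← mul_sub]
  exact abs_tsum_indicator_le (poissonPairMass_nonneg hlam.le) hB1 hf hf2 hR hSle A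

lemma sq_sqrt_two_div_pi_mul_rpow {z : ℝ} (hz : 0 ≤ z) (n : ℕ) :
    (√2 / Real.pi ^ ((1 : ℝ) / 4) * z ^ ((n : ℝ) / 2)) ^ 2 = 2 / √Real.pi * z ^ n := by
  rw [mul_pow, div_pow, Real.sq_sqrt zero_le_two, ← Real.rpow_mul_natCast Real.pi_pos.le,
    ← Real.rpow_mul_natCast hz, Real.sqrt_eq_rpow, ← Real.rpow_natCast z]
  norm_num

lemma two_div_sqrt_pi_ge : 1.12 ≤ 2 / √Real.pi := by
  have h : √Real.pi ≤ 1.78 := Real.sqrt_le_iff.2 ⟨by norm_num, by nlinarith [Real.pi_lt_d2]⟩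
  rw [le_div_iff₀ (by positivity)]
  linarith

/-- Lemma: total variation bound between paired Poisson mixtures. -/
theorem statement_15 (lam M : ℝ) (hlam : 0 < lam) (hM0 : 0 ≤ M) (hM : M ≤ lam / 2)
    (L : ℕ) (μ μ' : Measure ℝ) [IsProbabilityMeasure μ] [IsProbabilityMeasure μ']
    (hsupp : μ (Set.Icc (lam / 2 - M) (lam / 2 + M))ᶜ = 0)
    (hsupp' : μ' (Set.Icc (lam / 2 - M) (lam / 2 + M))ᶜ = 0)
    (hmom : ∀ ℓ : ℕ, 1 ≤ ℓ → ℓ ≤ L → ∫ v, v ^ ℓ ∂μ = ∫ v, v ^ ℓ ∂μ')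
    (hL : 8 * M ^ 2 / lam ≤ (L : ℝ) + 2) :
    tvOfMass (mixturePoissonPair μ lam) (mixturePoissonPair μ' lam) ≤
      Real.sqrt 2 / Real.pi ^ ((1 : ℝ) / 4) *
        (2 * Real.exp 1 * M ^ 2 / (lam * ((L : ℝ) + 1))) ^ (((L : ℝ) + 1) / 2) := by
  have hμ : ∀ᵐ v ∂μ, v ∈ Set.Icc (lam / 2 - M) (lam / 2 + M) := hsupp
  have hμ' : ∀ᵐ v ∂μ', v ∈ Set.Icc (lam / 2 - M) (lam / 2 + M) := hsupp'
  refine csSup_le ⟨_, ∅, rfl⟩ ?_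
  rintro _ ⟨A, rfl⟩
  refine abs_tsum_indicator_mixturePoissonPair_sub_le hlam hM0 hM hμ hμ' (Nat.le_add_left 1 L)
    (fun m hm => ?_) ?_ (by positivity) ?_ A
  · rcases m.eq_zero_or_pos with rfl | h0
    · simp [integralDiff]
    · exact sub_eq_zero.2 (hmom m h0 (by omega))
  · push_cast
    have : 8 * M ^ 2 / lam = 2 * (4 * M ^ 2 / lam) := by ring
    linarith
  · have hz : 0 ≤ 2 * Real.exp 1 * M ^ 2 / (lam * ((L : ℝ) + 1)) := by positivity
    have h := sq_sqrt_two_div_pi_mul_rpow hz (L + 1)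
    push_cast at h ⊢
    rw [h, show 4 * M ^ 2 / lam * Real.exp 1 / (2 * ((L : ℝ) + 1)) =
      2 * Real.exp 1 * M ^ 2 / (lam * ((L : ℝ) + 1)) by field_simp; ring]
    exact mul_le_mul_of_nonneg_right two_div_sqrt_pi_ge (by positivity)
end
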